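/- For every integer n ≥ 0, ζ⋆(2, 3, {1,3}^n) = −(1/(12ζ(2))) · ∑_{a+b+c = 2n+2, a,b,c ≥ 0} (−1)^a(1 − 2^{2a})·16^{−n}·ζ(2a)ζ(2b)ζ(2c+3)·( 2·δ_{c even} + (2i)^{c+1}·δ_{c odd} − 8·4^c ), where the right-hand side is computed in ℂ (with i the imaginary unit) and equals the real left-hand side. -/

import Mathlib

/-- The monotone index sequence `n_0 ≤ n_1 ≤ ⋯` of positive integers parametrized by the
gap function `g`: `n i = 1 + g 0 + g 1 + ⋯ + g i`.  Every weakly increasing tuple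
`1 ≤ n_0 ≤ ⋯ ≤ n_{d−1}` arises from exactly one `g : Fin d → ℕ`. -/
def idxSeq {d : ℕ} (g : Fin d → ℕ) (i : Fin d) : ℕ :=
  1 + ∑ j ∈ Finset.univ.filter (· ≤ i), g j

/-- The multiple zeta star value
`ζ⋆(s₁,…,s_d) = ∑_{1 ≤ n₁ ≤ n₂ ≤ ⋯ ≤ n_d} 1/(n₁^{s₁} ⋯ n_d^{s_d})`. -/
noncomputable def zetaStar {d : ℕ} (s : Fin d → ℕ) : ℝ :=
  ∑' g : Fin d → ℕ, ∏ i, 1 / (idxSeq g i : ℝ) ^ s i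

/-- The repeating string `{1,3}^n`: entries alternate `1, 3, 1, 3, …` (length `2n`). -/
def pat13 (n : ℕ) : Fin (2 * n) → ℕ := fun i => if (i : ℕ) % 2 = 0 then 1 else 3

/-! ### The kernel `cc N k = N!^2 / ((N-k)! (N+k)!)` -/

noncomputable def cc (N : ℕ) : ℕ → ℝ
  | 0 => 1
  | k + 1 => cc N k * (((N : ℝ) - k) / (N + k + 1))

noncomputable def LL (f : ℕ → ℝ) (k : ℕ) : ℝ := f k + 2 * ∑ i ∈ Finset.range k, f i

noncomputable def av (N : ℕ) (b : ℕ → ℝ) : ℝ := ∑ k ∈ Finset.range (N + 1), cc N k * b k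

noncomputable def mu (k : ℕ) : ℝ := (-1) ^ k / (k : ℝ) ^ 2

noncomputable def MLop (f : ℕ → ℝ) (k : ℕ) : ℝ := mu k * LL f k

noncomputable def cube (k : ℕ) : ℝ := 1 / (k : ℝ) ^ 3

lemma cc_step (N k : ℕ) : ((N : ℝ) - k) * cc N k = (N + k + 1) * cc N (k + 1) := by
  rw [cc]; have : (N + k + 1 : ℝ) ≠ 0 := by positivity
  field_simp

lemma cc_zero_of_lt (N k : ℕ) (h : N < k) : cc N k = 0 := by
  induction k with
  | zero => omega
  | succ k ih =>
    rw [cc]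
    rcases Nat.lt_or_ge N k with h' | h'
    · rw [ih h', zero_mul]
    · have : N = k := by omega
      subst this; simp

lemma cc_nonneg_le (N k : ℕ) : 0 ≤ cc N k ∧ cc N k ≤ 1 := by
  induction k with
  | zero => simp [cc]
  | succ k ih =>
    rcases Nat.lt_or_ge N (k + 1) with h' | h'
    · rw [cc_zero_of_lt _ _ h']; simp
    · have hk : (k : ℝ) + 1 ≤ N := by exact_mod_cast h'
      have hk0 : (0 : ℝ) ≤ k := Nat.cast_nonneg k
      rw [cc]
      have h1 : 0 ≤ ((N : ℝ) - k) / (N + k + 1) := by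
        apply div_nonneg <;> linarith
      have h2 : ((N : ℝ) - k) / (N + k + 1) ≤ 1 := by
        rw [div_le_one (by positivity)]; linarith
      exact ⟨mul_nonneg ih.1 h1, mul_le_one₀ ih.2 h1 h2⟩

lemma cc_tendsto (k : ℕ) : Filter.Tendsto (fun N => cc N k) Filter.atTop (nhds 1) := by
  induction k with
  | zero => simp [cc]
  | succ k ih =>
    have h : Filter.Tendsto (fun N : ℕ => ((N : ℝ) - k) / (N + k + 1)) Filter.atTop (nhds 1) := by
      have h1 : Filter.Tendsto (fun N : ℕ => 1 - (2 * (k : ℝ) + 1) / ((N : ℝ) + (k + 1)))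
          Filter.atTop (nhds (1 - 0)) := by
        refine Filter.Tendsto.sub tendsto_const_nhds ?_
        refine Filter.Tendsto.div_atTop tendsto_const_nhds ?_
        exact Filter.tendsto_atTop_add_const_right _ _ tendsto_natCast_atTop_atTop
      rw [sub_zero] at h1
      refine h1.congr fun N => ?_
      have : (N + (k + 1) : ℝ) ≠ 0 := by positivity
      have : (N + k + 1 : ℝ) ≠ 0 := by positivity
      field_simp
      ring
    simpa [cc] using ih.mul h

lemma cc_up (N k : ℕ) : ((N : ℝ) + 1) ^ 2 * cc N k = (((N : ℝ) + 1) ^ 2 - k ^ 2) * cc (N + 1) k := by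
  induction k with
  | zero => simp [cc]
  | succ k ih =>
    rw [cc, ← mul_assoc, ih, cc]
    push_cast
    have : (N + k + 1 : ℝ) ≠ 0 := by positivity
    have : (N + 1 + k + 1 : ℝ) ≠ 0 := by positivity
    field_simp
    ring

lemma av_up (b : ℕ → ℝ) (hb : b 0 = 0) (N : ℕ) :
    ∑ M ∈ Finset.range N, av (M + 1) (fun k => (k : ℝ) ^ 2 * b k) / ((M : ℝ) + 1) ^ 2 = av N b := by
  induction N with
  | zero => simp [av, hb]
  | succ N ih =>
    rw [Finset.sum_range_succ, ih]
    have h0 : av N b = ∑ k ∈ Finset.range (N + 1 + 1), cc N k * b k := by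
      rw [Finset.sum_range_succ, cc_zero_of_lt N (N + 1) (by omega), av]; simp
    rw [h0, av, av, Finset.sum_div, ← Finset.sum_add_distrib]
    refine Finset.sum_congr rfl fun k _ => ?_
    have := cc_up N k
    have h1 : ((N : ℝ) + 1) ^ 2 ≠ 0 := by positivity
    have h2 : cc N k = (((N : ℝ) + 1) ^ 2 - k ^ 2) * cc (N + 1) k / ((N : ℝ) + 1) ^ 2 := by
      rw [eq_div_iff h1, ← this]; ring
    rw [h2]
    field_simp
    ring

lemma av_mul (a : ℕ → ℝ) (N : ℕ) : (N : ℝ) * av N a = av N (fun k => k * LL a k) := by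
  have key : ∀ K : ℕ, ∑ k ∈ Finset.range (K + 1), (cc N k * (N - k) * a k -
      2 * k * cc N k * ∑ i ∈ Finset.range k, a i) = (N - K) * cc N K * ∑ i ∈ Finset.range (K + 1), a i := by
    intro K
    induction K with
    | zero => simp [cc]
    | succ K ih =>
      rw [Finset.sum_range_succ, ih, cc_step, Finset.sum_range_succ _ (K + 1)]
      push_cast
      ring
  have h := key N
  rw [sub_self, zero_mul, zero_mul] at h
  have : (N : ℝ) * av N a - av N (fun k => k * LL a k) = 0 := by
    rw [← h, av, av, Finset.mul_sum, ← Finset.sum_sub_distrib]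
    refine Finset.sum_congr rfl fun k _ => ?_
    rw [LL]; ring
  linarith

lemma LL_inv (f : ℕ → ℝ) (k : ℕ) : LL (fun j => (-1) ^ j * LL f j) k = (-1) ^ k * f k := by
  have key : ∀ k : ℕ, ∑ i ∈ Finset.range k, (-1) ^ i * LL f i = -(-1) ^ k * ∑ i ∈ Finset.range k, f i := by
    intro k
    induction k with
    | zero => simp
    | succ k ih => rw [Finset.sum_range_succ, ih, Finset.sum_range_succ, LL, pow_succ]; ring
  rw [LL, key, LL]; ring

lemma av_div (a : ℕ → ℝ) (ha : a 0 = 0) (N : ℕ) :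
    av (N + 1) a / ((N : ℝ) + 1) =
      av (N + 1) (fun j => (-1) ^ j * LL (fun i => (-1) ^ i * a i / i) j) := by
  have h : ((N : ℝ) + 1) ≠ 0 := by positivity
  have := av_mul (fun j => (-1) ^ j * LL (fun i => (-1) ^ i * a i / i) j) (N + 1)
  rw [div_eq_iff h, mul_comm]
  push_cast at this
  rw [this]
  simp only [LL_inv]
  congr 1
  ext k
  rcases Nat.eq_zero_or_pos k with rfl | hk
  · simp [ha]
  · have : (k : ℝ) ≠ 0 := by positivity
    have h2 : ((-1 : ℝ) ^ k) * (-1) ^ k = 1 := by rw [← mul_pow]; simp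
    field_simp
    rw [sq, h2, mul_one]

lemma av_base (N : ℕ) : av (N + 1) (fun k => if k = 0 then 0 else -2 * (-1) ^ k) = 1 := by
  have key : ∀ K : ℕ, ∑ k ∈ Finset.range (K + 1), cc (N + 1) k * (if k = 0 then 0 else -2 * (-1) ^ k)
     = 1 - (-1) ^ K * ((((N + 1 : ℕ) : ℝ) - K) * cc (N + 1) K) / (N + 1) := by
    intro K
    have : ((N : ℝ) + 1) ≠ 0 := by positivity
    induction K with
    | zero => simp [cc, this]
    | succ K ih =>
      rw [Finset.sum_range_succ, ih, cc_step, if_neg (by omega)]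
      push_cast
      field_simp
      ring
  rw [av, key]; simp

/-- Iterated truncated star sums. -/
noncomputable def Ssum (e : ℕ → ℕ) : ℕ → ℕ → ℝ
  | 0, _ => 1
  | d + 1, N => ∑ M ∈ Finset.range N, Ssum e d (M + 1) / ((M : ℝ) + 1) ^ (e d)

def expo (i : ℕ) : ℕ := if i = 0 then 2 else if i % 2 = 1 then 3 else 1

lemma mu_zero : mu 0 = 0 := by simp [mu]
lemma MLop_zero (f : ℕ → ℝ) : MLop f 0 = 0 := by simp [MLop, mu_zero]
lemma cube_zero : cube 0 = 0 := by simp [cube]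

lemma Ssum_up2 (F : ℕ → ℝ) (b : ℕ → ℝ) (hb : b 0 = 0)
    (h : ∀ M : ℕ, F (M + 1) = av (M + 1) (fun k => (k : ℝ) ^ 2 * b k)) (N : ℕ) :
    ∑ M ∈ Finset.range N, F (M + 1) / ((M : ℝ) + 1) ^ 2 = av N b := by
  rw [← av_up b hb]
  exact Finset.sum_congr rfl fun M _ => by rw [h]

lemma Ssum_up3 (F : ℕ → ℝ) (b : ℕ → ℝ) (hb : b 0 = 0) (h : ∀ M : ℕ, F M = av M b) (N : ℕ) :
    ∑ M ∈ Finset.range N, F (M + 1) / ((M : ℝ) + 1) ^ 3 = av N (MLop fun i => (-1) ^ i * b i / i) := by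
  rw [← Ssum_up2 (fun M => F M / M) (MLop fun i => (-1) ^ i * b i / i) (MLop_zero _)]
  · refine Finset.sum_congr rfl fun M _ => ?_
    push_cast
    have : ((M : ℝ) + 1) ≠ 0 := by positivity
    field_simp
  · intro M
    push_cast
    rw [h, av_div b hb]
    congr 1
    ext k
    rcases Nat.eq_zero_or_pos k with rfl | hk
    · simp [LL]
    · have : (k : ℝ) ≠ 0 := by positivity
      rw [MLop, mu]
      field_simp

lemma Ssum_up1 (F : ℕ → ℝ) (b : ℕ → ℝ) (h : ∀ M : ℕ, F M = av M b) (N : ℕ) :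
    ∑ M ∈ Finset.range N, F (M + 1) / ((M : ℝ) + 1) ^ 1 = av N (fun k => LL b k / k) := by
  rw [← Ssum_up2 (fun M => F M * M) (fun k => LL b k / k) (by simp)]
  · refine Finset.sum_congr rfl fun M _ => ?_
    push_cast
    have : ((M : ℝ) + 1) ≠ 0 := by positivity
    field_simp
  · intro M
    rw [h, mul_comm, av_mul]
    congr 1
    ext k
    rcases Nat.eq_zero_or_pos k with rfl | hk
    · simp
    · have : (k : ℝ) ≠ 0 := by positivity
      field_simp

lemma LL_smul (c : ℝ) (f : ℕ → ℝ) (k : ℕ) : LL (fun i => c * f i) k = c * LL f k := by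
  simp only [LL, ← Finset.mul_sum]; ring

lemma neg_one_sq' (k : ℕ) : ((-1 : ℝ) ^ k) * (-1) ^ k = 1 := by rw [← mul_pow]; simp

lemma Ssum_eq (r : ℕ) : ∀ N, Ssum expo (2 * r + 2) N = av N (fun k => -2 * (MLop^[2 * r + 1] cube) k) := by
  induction r with
  | zero =>
    have h1 : ∀ N, Ssum expo 1 N = av N (fun k => -2 * mu k) := by
      intro N
      refine Ssum_up2 (Ssum expo 0) (fun k => -2 * mu k) (by simp [mu_zero]) ?_ N
      intro M
      rw [Ssum, ← av_base M]
      congr 1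
      ext k
      rcases Nat.eq_zero_or_pos k with rfl | hk
      · simp
      · have : (k : ℝ) ≠ 0 := by positivity
        rw [if_neg (by omega), mu]
        field_simp
    intro N
    have := Ssum_up3 (Ssum expo 1) _ (by simp [mu_zero]) h1 N
    have e1 : Ssum expo (2 * 0 + 2) N = ∑ M ∈ Finset.range N, Ssum expo 1 (M + 1) / ((M : ℝ) + 1) ^ 3 := rfl
    rw [e1, this]
    congr 1
    ext k
    have e2 : (fun i : ℕ => (-1 : ℝ) ^ i * (-2 * mu i) / i) = fun i => -2 * cube i := by
      ext i
      rw [mu, cube]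
      have := neg_one_sq' i
      rw [show (-1 : ℝ) ^ i * (-2 * ((-1) ^ i / (i : ℝ) ^ 2)) / i
        = -2 * ((-1 : ℝ) ^ i * (-1) ^ i) / ((i : ℝ) ^ 2 * i) by ring, this]
      ring
    rw [MLop, e2, LL_smul]
    simp [MLop]
    ring
  | succ r ih =>
    intro N
    have e1 : ∀ N, Ssum expo (2 * r + 3) N = av N (fun k => LL (fun k => -2 * (MLop^[2 * r + 1] cube) k) k / k) := by
      intro N
      rw [← Ssum_up1 _ _ ih]
      rw [Ssum]
      have : expo (2 * r + 2) = 1 := by simp [expo]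
      rw [this]
    have h3 := Ssum_up3 _ _ (by simp) e1 N
    have e2 : Ssum expo (2 * (r + 1) + 2) N = ∑ M ∈ Finset.range N, Ssum expo (2 * r + 3) (M + 1) / ((M : ℝ) + 1) ^ 3 := by
      rw [show 2 * (r + 1) + 2 = 2 * r + 3 + 1 by ring, Ssum]
      have : expo (2 * r + 3) = 3 := by simp [expo]
      rw [this]
    rw [e2, h3]
    congr 1
    ext k
    have e0 : MLop^[2 * (r + 1) + 1] cube = MLop (MLop (MLop^[2 * r + 1] cube)) := by
      rw [show 2 * (r + 1) + 1 = (2 * r + 1) + 1 + 1 by ring, Function.iterate_succ_apply' _ (2 * r + 1 + 1), Function.iterate_succ_apply' _ (2 * r + 1)]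
    rw [e0]
    generalize MLop^[2 * r + 1] cube = f
    have e3 : (fun i : ℕ => (-1 : ℝ) ^ i * (LL (fun k => -2 * f k) i / i) / i) = fun i => -2 * MLop f i := by
      ext i
      rw [LL_smul, MLop, mu]; ring
    rw [MLop, e3, LL_smul, MLop]; ring

lemma summable_MLop (f : ℕ → ℝ) (hf : Summable (fun k => |f k|)) : Summable (fun k => |MLop f k|) := by
  set C := ∑' k, |f k|
  have hC : ∀ s : Finset ℕ, ∑ i ∈ s, |f i| ≤ C := fun s => hf.sum_le_tsum s fun _ _ => abs_nonneg _
  have h2 : ∀ k, |LL f k| ≤ 3 * C := by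
    intro k
    rw [LL]
    have h1 := hC {k}
    have h2 := hC (Finset.range k)
    have h3 := Finset.abs_sum_le_sum_abs f (Finset.range k)
    rw [Finset.sum_singleton] at h1
    calc |f k + 2 * ∑ i ∈ Finset.range k, f i| ≤ |f k| + |2 * ∑ i ∈ Finset.range k, f i| := abs_add_le _ _
      _ = |f k| + 2 * |∑ i ∈ Finset.range k, f i| := by rw [abs_mul, abs_two]
      _ ≤ 3 * C := by linarith
  have h3 : Summable (fun k : ℕ => (3 * C) * (1 / (k : ℝ) ^ 2)) :=
    (Real.summable_one_div_nat_pow.mpr (by norm_num)).mul_left _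
  refine Summable.of_nonneg_of_le (fun _ => abs_nonneg _) (fun k => ?_) h3
  rw [MLop, abs_mul, mul_comm, mu, abs_div, abs_pow, abs_neg, abs_one, one_pow, abs_pow, Nat.abs_cast]
  exact mul_le_mul_of_nonneg_right (h2 k) (by positivity)

lemma summable_iter (m : ℕ) : Summable (fun k => |(MLop^[m] cube) k|) := by
  induction m with
  | zero =>
    have : Summable (fun k : ℕ => 1 / (k : ℝ) ^ 3) := Real.summable_one_div_nat_pow.mpr (by norm_num)
    refine this.congr fun k => ?_
    simp [cube]
  | succ m ih => rw [Function.iterate_succ_apply']; exact summable_MLop _ ih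

lemma av_tendsto (b : ℕ → ℝ) (hb : Summable (fun k => |b k|)) :
    Filter.Tendsto (fun N => av N b) Filter.atTop (nhds (∑' k, b k)) := by
  have h := tendsto_tsum_of_dominated_convergence (𝓕 := Filter.atTop) (f := fun N k => cc N k * b k) (g := b)
    (bound := fun k => |b k|) hb ?_ ?_
  · refine h.congr fun N => ?_
    rw [av]
    refine tsum_eq_sum fun k hk => ?_
    rw [cc_zero_of_lt N k (by simpa using hk), zero_mul]
  · intro k
    simpa using (cc_tendsto k).mul_const (b k)
  · refine Filter.Eventually.of_forall fun N k => ?_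
    rw [norm_mul, Real.norm_eq_abs, Real.norm_eq_abs, abs_of_nonneg (cc_nonneg_le N k).1]
    exact mul_le_of_le_one_left (abs_nonneg _) (cc_nonneg_le N k).2

lemma Ssum_tendsto (r : ℕ) : Filter.Tendsto (fun N => Ssum expo (2 * r + 2) N) Filter.atTop
    (nhds (-2 * ∑' k, (MLop^[2 * r + 1] cube) k)) := by
  rw [← tsum_mul_left]
  simp only [Ssum_eq]
  refine av_tendsto _ ?_
  simp only [abs_mul]
  exact (summable_iter _).mul_left _

/-- The products `Q_k`, truncating at `k = n`. -/
noncomputable def QQ (n : ℕ) (w : ℝ) : ℕ → ℝ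
  | 0 => 1
  | k + 1 => QQ n w k * (if Even (k + 1 + n) then (((k + 1 : ℕ) : ℝ) ^ 2 - n ^ 2) / (((k + 1 : ℕ) : ℝ) ^ 2 + w)
      else (((k + 1 : ℕ) : ℝ) ^ 2 + w) / (((k + 1 : ℕ) : ℝ) ^ 2 - n ^ 2))

/-- Partial sums with sign normalised relative to `n`. -/
noncomputable def TT (n : ℕ) (w : ℝ) : ℕ → ℝ
  | 0 => 0
  | k + 1 => TT n w k + (if Even (k + 1 + n) then (1 : ℝ) else -1) *
      (QQ n w (k + 1) - QQ n w k) / ((k + 1 : ℕ) : ℝ)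

noncomputable def RR (n k : ℕ) : ℝ :=
  if Even (k + n) then ((n : ℝ) + 2 + k) * (n + 1 - k) / ((n - k) * (n + 1 + k))
  else ((n : ℝ) + 1 + k) * (n - k) / ((n + 1 - k) * (n + 2 + k))

noncomputable def GG (n : ℕ) (w : ℝ) (k : ℕ) : ℝ :=
  -(2 / n) / (((n : ℝ) ^ 2 + w) * (((n : ℝ) + 2) ^ 2 + w)) *
  (if Even (k + n) then (w ^ 2 + w * (((n : ℝ) + 1) ^ 2 + 2 + k * (k + 1)) - n * (n + 2)
      + (((n : ℝ) + 1) ^ 2 + 1) * (k * (k + 1))) / ((n + 1 + k) * (n - k))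
   else (-w * (((n : ℝ) + 1) ^ 2 - k * (k + 1)) - ((n : ℝ) + 1) ^ 2 * (((n : ℝ) + 1) ^ 2 + 3)
      + (((n : ℝ) + 1) ^ 2 + 1) * (k * (k + 1))) / ((n + 2 + k) * (n + 1 - k)))


lemma even_aux (k n : ℕ) (h : Even (k + 1 + n)) : ¬ Even (k + n) := by
  rw [Nat.even_iff] at *; omega

lemma even_aux' (k n : ℕ) (h : ¬ Even (k + 1 + n)) : Even (k + n) := by
  rw [Nat.even_iff] at *; omega

lemma even_aux2 (k n : ℕ) : Even (k + 1 + (n + 2)) ↔ Even (k + 1 + n) := by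
  rw [Nat.even_iff, Nat.even_iff]; omega

lemma QQ_ratio (n : ℕ) (w : ℝ) (hw : 0 < w) (k : ℕ) (hk : k < n) :
    QQ (n + 2) w k * RR n 0 = RR n k * QQ n w k := by
  induction k with
  | zero => simp [QQ]
  | succ k ih =>
    have ih := ih (by omega)
    have hn : ((k : ℝ) + 1 + 1 ≤ n) := by exact_mod_cast hk
    have hk0 : (0 : ℝ) ≤ k := Nat.cast_nonneg k
    obtain ⟨y, hy⟩ : ∃ y : ℝ, y = n - k - 2 := ⟨_, rfl⟩
    have hy0 : 0 ≤ y := by linarith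
    have hny : (n : ℝ) = y + k + 2 := by linarith
    simp only [QQ, even_aux2]
    rw [mul_right_comm, ih]
    have a1 : ((k : ℝ) + 1) ^ 2 + w ≠ 0 := by positivity
    have b1 : (y + k + 2 + 1 - k : ℝ) ≠ 0 := by intro h; linarith
    have b2 : (y + k + 2 - k : ℝ) ≠ 0 := by intro h; linarith
    have b3 : (y + k + 2 + 1 - (k + 1) : ℝ) ≠ 0 := by intro h; linarith
    have b4 : (y + k + 2 - (k + 1) : ℝ) ≠ 0 := by intro h; linarith
    have b5 : ((k + 1) ^ 2 - (y + k + 2) ^ 2 : ℝ) ≠ 0 := by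
      have : ((k + 1) ^ 2 - (y + k + 2) ^ 2 : ℝ) = - ((y + 1) * (y + 2 * k + 3)) := by ring
      rw [this, neg_ne_zero]; positivity
    have b6 : ((k + 1) ^ 2 - (y + k + 2 + 2) ^ 2 : ℝ) ≠ 0 := by
      have : ((k + 1) ^ 2 - (y + k + 2 + 2) ^ 2 : ℝ) = - ((y + 3) * (y + 2 * k + 5)) := by ring
      rw [this, neg_ne_zero]; positivity
    have b7 : (y + k + 2 + 1 + k : ℝ) ≠ 0 := by positivity
    have b8 : (y + k + 2 + 2 + k : ℝ) ≠ 0 := by positivity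
    have b9 : (y + k + 2 + 1 + (k + 1) : ℝ) ≠ 0 := by positivity
    have b10 : (y + k + 2 + 2 + (k + 1) : ℝ) ≠ 0 := by positivity
    by_cases h : Even (k + 1 + n)
    · have h' := even_aux _ _ h
      simp only [RR, h, h', if_true, if_false]
      push_cast
      rw [hny]
      field_simp
      ring
    · have h' := even_aux' _ _ h
      simp only [RR, h, h', if_true, if_false]
      push_cast
      rw [hny]
      field_simp
      ring

lemma TT_wz (n : ℕ) (w : ℝ) (hw : 0 < w) (k : ℕ) (hk : k < n) :
    TT (n + 2) w k * RR n 0 * ((n + 2) / n) / (((n : ℝ) + 2) ^ 2 + w) =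
      TT n w k / ((n : ℝ) ^ 2 + w) + GG n w k * QQ n w k - GG n w 0 := by
  induction k with
  | zero => simp [QQ, TT]
  | succ k ih =>
    have ih := ih (by omega)
    have r0 := QQ_ratio n w hw k (by omega)
    have r1 := QQ_ratio n w hw (k + 1) hk
    have hn : ((k : ℝ) + 1 + 1 ≤ n) := by exact_mod_cast hk
    have hk0 : (0 : ℝ) ≤ k := Nat.cast_nonneg k
    obtain ⟨y, hy⟩ : ∃ y : ℝ, y = n - k - 2 := ⟨_, rfl⟩
    have hy0 : 0 ≤ y := by linarith
    have hny : (n : ℝ) = y + k + 2 := by linarith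
    have a0 : (y + k + 2 : ℝ) ≠ 0 := by positivity
    have a1 : ((k : ℝ) + 1) ^ 2 + w ≠ 0 := by positivity
    have a2 : ((y + k + 2) ^ 2 + w : ℝ) ≠ 0 := by positivity
    have a3 : ((y + k + 2 + 2) ^ 2 + w : ℝ) ≠ 0 := by positivity
    have a4 : (k + 1 : ℝ) ≠ 0 := by positivity
    have b1 : (y + k + 2 + 1 - k : ℝ) ≠ 0 := by intro h; linarith
    have b2 : (y + k + 2 - k : ℝ) ≠ 0 := by intro h; linarith
    have b3 : (y + k + 2 + 1 - (k + 1) : ℝ) ≠ 0 := by intro h; linarith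
    have b4 : (y + k + 2 - (k + 1) : ℝ) ≠ 0 := by intro h; linarith
    have b5 : ((k + 1) ^ 2 - (y + k + 2) ^ 2 : ℝ) ≠ 0 := by
      have : ((k + 1) ^ 2 - (y + k + 2) ^ 2 : ℝ) = - ((y + 1) * (y + 2 * k + 3)) := by ring
      rw [this, neg_ne_zero]; positivity
    have b7 : (y + k + 2 + 1 + k : ℝ) ≠ 0 := by positivity
    have b8 : (y + k + 2 + 2 + k : ℝ) ≠ 0 := by positivity
    have b9 : (y + k + 2 + 1 + (k + 1) : ℝ) ≠ 0 := by positivity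
    have b10 : (y + k + 2 + 2 + (k + 1) : ℝ) ≠ 0 := by positivity
    have e1 : TT (n + 2) w (k + 1) * RR n 0 * ((n + 2) / n) / (((n : ℝ) + 2) ^ 2 + w)
       = TT (n + 2) w k * RR n 0 * ((n + 2) / n) / (((n : ℝ) + 2) ^ 2 + w)
        + (if Even (k + 1 + n) then (1 : ℝ) else -1) *
         (RR n (k + 1) * QQ n w (k + 1) - RR n k * QQ n w k) / (k + 1)
          * ((n + 2) / n) / (((n : ℝ) + 2) ^ 2 + w) := by
      rw [← r0, ← r1]; simp only [TT, even_aux2]; push_cast; ring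
    rw [e1, ih]
    have e2 : TT n w (k + 1) = TT n w k + (if Even (k + 1 + n) then (1 : ℝ) else -1) *
      (QQ n w (k + 1) - QQ n w k) / (k + 1) := by simp only [TT]; push_cast; rfl
    rw [e2]
    by_cases h : Even (k + 1 + n)
    · have h' := even_aux _ _ h
      have e3 : QQ n w (k + 1) = QQ n w k * (((k + 1) ^ 2 - n ^ 2) / ((k + 1) ^ 2 + w)) := by
        simp only [QQ, h, if_true]; push_cast; rfl
      rw [e3]
      have hg : GG n w 0 = GG n w 0 := rfl
      generalize TT n w k = t
      generalize GG n w 0 = g0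
      simp only [RR, GG, h, h', if_true, if_false]
      push_cast
      rw [hny]
      field_simp
      ring
    · have h' := even_aux' _ _ h
      have e3 : QQ n w (k + 1) = QQ n w k * (((k + 1) ^ 2 + w) / ((k + 1) ^ 2 - n ^ 2)) := by
        simp only [QQ, h, if_false]; push_cast; rfl
      rw [e3]
      generalize TT n w k = t
      generalize GG n w 0 = g0
      simp only [RR, GG, h, h', if_true, if_false]
      push_cast
      rw [hny]
      field_simp
      ring

lemma TT_step (n : ℕ) (w : ℝ) (hw : 0 < w) (hn : 0 < n) :
    TT (n + 2) w (n + 2) * RR n 0 * ((n + 2) / n) / (((n : ℝ) + 2) ^ 2 + w) =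
      TT n w n / ((n : ℝ) ^ 2 + w) - GG n w 0 := by
  obtain ⟨k, rfl⟩ : ∃ k, n = k + 1 := ⟨n - 1, by omega⟩
  have h1 := TT_wz (k + 1) w hw k (by omega)
  have h2 := QQ_ratio (k + 1) w hw k (by omega)
  have p1 : Even (k + 1 + (k + 1 + 2)) := by rw [Nat.even_iff]; omega
  have p2 : ¬ Even (k + 1 + 1 + (k + 1 + 2)) := by rw [Nat.even_iff]; omega
  have p3 : Even (k + 1 + 1 + 1 + (k + 1 + 2)) := by rw [Nat.even_iff]; omega
  have p4 : Even (k + 1 + (k + 1)) := by rw [Nat.even_iff]; omega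
  have p5 : ¬ Even (k + (k + 1)) := by rw [Nat.even_iff]; omega
  have q0 : QQ (k + 1) w (k + 1) = 0 := by simp [QQ, p4]
  have q1 : QQ (k + 1 + 2) w (k + 1 + 1 + 1) = 0 := by
    simp only [QQ, p1, p2, p3, if_true]; push_cast; ring
  have hT : TT (k + 1) w (k + 1) = TT (k + 1) w k - QQ (k + 1) w k / (k + 1) := by
    rw [TT, q0]; simp only [p4, if_true]; push_cast; ring
  have a1 : ((k : ℝ) + 1) ^ 2 + w ≠ 0 := by positivity
  have hT' : TT (k + 1 + 2) w (k + 1 + 2) = TT (k + 1 + 2) w k +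
     QQ (k + 1 + 2) w k * (((((k + 1) ^ 2 - (k + 3) ^ 2) / ((k + 1) ^ 2 + w)) - 1) / (k + 1)
      - ((((k + 1) ^ 2 - (k + 3) ^ 2) / ((k + 1) ^ 2 + w)) *
         (((k + 2) ^ 2 + w) / ((k + 2) ^ 2 - (k + 3) ^ 2)) - ((k + 1) ^ 2 - (k + 3) ^ 2) / ((k + 1) ^ 2 + w)) / (k + 2)
      - ((((k + 1) ^ 2 - (k + 3) ^ 2) / ((k + 1) ^ 2 + w)) *
         (((k + 2) ^ 2 + w) / ((k + 2) ^ 2 - (k + 3) ^ 2))) / (k + 3)) := by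
    rw [show k + 1 + 2 = k + 1 + 1 + 1 from rfl, TT, TT, TT]
    rw [show k + 1 + 1 + 1 = k + 1 + 2 from rfl] at *
    rw [q1]
    simp only [p1, p2, p3, QQ, if_true, if_false]
    push_cast
    ring
  have b5 : ((k + 2) ^ 2 - (k + 3) ^ 2 : ℝ) ≠ 0 := by
    have : ((k + 2) ^ 2 - (k + 3) ^ 2 : ℝ) = - (2 * k + 5) := by ring
    rw [this, neg_ne_zero]; positivity
  have h3 : QQ (k + 1 + 2) w k * RR (k + 1) 0 = (k + 1) / (2 * k + 3) * QQ (k + 1) w k := by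
    rw [h2, RR, if_neg p5]; push_cast
    have c1 : ((k : ℝ) + 1 + 1 - k) ≠ 0 := by ring_nf; norm_num
    have c2 : ((k : ℝ) + 1 + 2 + k) ≠ 0 := by positivity
    field_simp
    ring
  rw [hT']
  generalize hX : (((((k + 1) ^ 2 - (k + 3) ^ 2) / ((k + 1) ^ 2 + w)) - 1) / (k + 1)
      - ((((k + 1) ^ 2 - (k + 3) ^ 2) / ((k + 1) ^ 2 + w)) *
         (((k + 2) ^ 2 + w) / ((k + 2) ^ 2 - (k + 3) ^ 2)) - ((k + 1) ^ 2 - (k + 3) ^ 2) / ((k + 1) ^ 2 + w)) / (k + 2)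
      - ((((k + 1) ^ 2 - (k + 3) ^ 2) / ((k + 1) ^ 2 + w)) *
         (((k + 2) ^ 2 + w) / ((k + 2) ^ 2 - (k + 3) ^ 2))) / (k + 3) : ℝ) = X
  have : (TT (k + 1 + 2) w k + QQ (k + 1 + 2) w k * X) * RR (k + 1) 0 *
     ((((k + 1 : ℕ) : ℝ) + 2) / ((k + 1 : ℕ) : ℝ)) / ((((k + 1 : ℕ) : ℝ) + 2) ^ 2 + w) =
     TT (k + 1 + 2) w k * RR (k + 1) 0 * ((((k + 1 : ℕ) : ℝ) + 2) / ((k + 1 : ℕ) : ℝ)) / ((((k + 1 : ℕ) : ℝ) + 2) ^ 2 + w)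
     + (QQ (k + 1 + 2) w k * RR (k + 1) 0) * X * ((((k + 1 : ℕ) : ℝ) + 2) / ((k + 1 : ℕ) : ℝ)) / ((((k + 1 : ℕ) : ℝ) + 2) ^ 2 + w) := by ring
  rw [this, h1, h3, hT, ← hX]
  generalize TT (k + 1) w k = t
  generalize GG (k + 1) w 0 = g0
  generalize QQ (k + 1) w k = q
  rw [GG, if_neg p5]
  push_cast
  have c1 : ((k : ℝ) + 1 + 1 - k) ≠ 0 := by ring_nf; norm_num
  have a2 : ((k : ℝ) + 1 + 2) ^ 2 + w ≠ 0 := by positivity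
  field_simp
  ring

lemma TT_odd (p : ℕ) (w : ℝ) (hw : 0 < w) :
    TT (2 * p + 1) w (2 * p + 1) = -(1 / (2 * p + 1) + ((2 * p + 1) ^ 2 + w) *
      ∑ i ∈ Finset.range p, 2 / ((2 * i + 1) * ((2 * (i : ℝ) + 1) ^ 2 + w))) := by
  induction p with
  | zero => simp [TT, QQ]
  | succ p ih =>
    have h := TT_step (2 * p + 1) w hw (by omega)
    rw [ih] at h
    have p1 : ¬ Even (0 + (2 * p + 1)) := by rw [Nat.even_iff]; omega
    simp only [RR, GG, if_neg p1] at h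
    rw [show 2 * (p + 1) + 1 = 2 * p + 1 + 2 by ring, Finset.sum_range_succ]
    push_cast at h ⊢
    have a1 : (2 * (p : ℝ) + 1) ^ 2 + w ≠ 0 := by positivity
    have a2 : (2 * (p : ℝ) + 1 + 2) ^ 2 + w ≠ 0 := by positivity
    have a3 : (2 * (p : ℝ) + 1 + 1 + 0) ≠ 0 := by positivity
    generalize ∑ i ∈ Finset.range p, 2 / ((2 * i + 1) * ((2 * (i : ℝ) + 1) ^ 2 + w)) = s at *
    generalize TT (2 * p + 1 + 2) w (2 * p + 1 + 2) = t at *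
    have a4 : (2 * (p : ℝ) + 1 + 2 + 0) ≠ 0 := by positivity
    have a5 : (2 * (p : ℝ) + 1 + 1 - 0) ≠ 0 := by rw [sub_zero]; positivity
    have e : t * ((2 * (p:ℝ) + 1 + 1 + 0) * (2 * p + 1 - 0) / ((2 * p + 1 + 1 - 0) * (2 * p + 1 + 2 + 0))) *
        ((2 * p + 1 + 2) / (2 * p + 1)) / ((2 * p + 1 + 2) ^ 2 + w) = t / ((2 * p + 1 + 2) ^ 2 + w) := by
      field_simp
      ring
    rw [e, div_eq_iff a2] at h
    rw [h]
    have a6 : (2 * ((p : ℝ) + 1) + 1) ≠ 0 := by positivity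
    field_simp
    ring

lemma TT_even (p : ℕ) (w : ℝ) (hw : 0 < w) :
    TT (2 * p + 2) w (2 * p + 2) = -1 / (2 * p + 2) + ((2 * p + 2) ^ 2 + w) *
      (2 / (2 * p + 2) ^ 2) * (∑ i ∈ Finset.range (p + 1), 1 / (2 * (i : ℝ) + 1)
       - ∑ i ∈ Finset.range p, (2 * i + 2) / ((2 * (i : ℝ) + 2) ^ 2 + w)) := by
  induction p with
  | zero =>
    have p1 : ¬ Even (1 + 2) := by decide
    simp [TT, QQ, p1]
    have : (4 + w) ≠ 0 := by positivity
    have : (1 + w) ≠ 0 := by positivity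
    norm_num
    field_simp
    ring
  | succ p ih =>
    have h := TT_step (2 * p + 2) w hw (by omega)
    rw [ih] at h
    have p1 : Even (0 + (2 * p + 2)) := by rw [Nat.even_iff]; omega
    simp only [RR, GG, if_pos p1] at h
    rw [show 2 * (p + 1) + 2 = 2 * p + 2 + 2 by ring, Finset.sum_range_succ _ (p + 1),
      Finset.sum_range_succ _ p]
    push_cast at h ⊢
    have a1 : (2 * (p : ℝ) + 2) ^ 2 + w ≠ 0 := by positivity
    have a2 : (2 * (p : ℝ) + 2 + 2) ^ 2 + w ≠ 0 := by positivity
    have a3 : (2 * (p : ℝ) + 2 + 1 + 0) ≠ 0 := by positivity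
    rw [Finset.sum_range_succ] at h ⊢
    generalize ∑ i ∈ Finset.range p, 1 / (2 * (i : ℝ) + 1) = s1 at *
    generalize ∑ i ∈ Finset.range p, (2 * i + 2) / ((2 * (i : ℝ) + 2) ^ 2 + w) = s at *
    generalize TT (2 * p + 2 + 2) w (2 * p + 2 + 2) = t at *
    have a4 : (2 * (p : ℝ) + 2 + 2 + 0) ≠ 0 := by positivity
    have a5 : (2 * (p : ℝ) + 2 - 0) ≠ 0 := by rw [sub_zero]; positivity
    have e : t * ((2 * (p:ℝ) + 2 + 2 + 0) * (2 * p + 2 + 1 - 0) / ((2 * p + 2 - 0) * (2 * p + 2 + 1 + 0))) *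
        ((2 * p + 2 + 2) / (2 * p + 2)) / ((2 * p + 2 + 2) ^ 2 + w) = t * ((2 * p + 4) ^ 2 / ((2 * p + 2) ^ 2 * ((2 * p + 2 + 2) ^ 2 + w))) := by
      field_simp
      ring
    rw [e, ← eq_div_iff (by positivity)] at h
    rw [h]
    field_simp
    ring

/-! ### From `zetaStar` to truncated sums -/

open scoped ENNReal in
noncomputable def Acoef (w : ℕ → ℕ → ℝ≥0∞) : ℕ → ℕ → ℝ≥0∞
  | 0, N => if N = 1 then 1 else 0
  | d + 1, N => w d N * ∑ M ∈ Finset.range (N + 1), Acoef w d M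

lemma idxSeq_snoc_castSucc {d : ℕ} (g : Fin d → ℕ) (x : ℕ) (i : Fin d) :
    idxSeq (Fin.snoc g x : Fin (d + 1) → ℕ) i.castSucc = idxSeq g i := by
  unfold idxSeq
  congr 1
  rw [Finset.sum_filter, Finset.sum_filter, Fin.sum_univ_castSucc]
  simp [Fin.last_le_iff, (Fin.castSucc_lt_last i).ne]

lemma idxSeq_snoc_last {d : ℕ} (g : Fin d → ℕ) (x : ℕ) :
    idxSeq (Fin.snoc g x : Fin (d + 1) → ℕ) (Fin.last d) = 1 + ∑ i, g i + x := by
  unfold idxSeq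
  rw [Finset.sum_filter, Fin.sum_univ_castSucc]
  simp [Fin.le_last]
  ring

open scoped ENNReal in
lemma tsum_conv (a g : ℕ → ℝ≥0∞) :
    ∑' M : ℕ, ∑' x : ℕ, a M * g (M + x) = ∑' N : ℕ, (∑ M ∈ Finset.range (N + 1), a M) * g N := by
  rw [← ENNReal.tsum_prod (f := fun M x => a M * g (M + x))]
  rw [← Finset.HasAntidiagonal.sigmaAntidiagonalEquivProd.tsum_eq, ENNReal.tsum_sigma']
  refine tsum_congr fun N => ?_
  rw [Finset.sum_mul, ← Finset.Nat.sum_antidiagonal_eq_sum_range_succ_mk (f := fun p => a p.1 * g N)]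
  rw [tsum_fintype]
  rw [← Finset.sum_coe_sort (Finset.HasAntidiagonal.antidiagonal N)]
  refine Finset.sum_congr rfl fun p _ => ?_
  have := Finset.HasAntidiagonal.mem_antidiagonal.mp p.2
  simp only [Finset.HasAntidiagonal.sigmaAntidiagonalEquivProd_apply]
  rw [this]

open scoped ENNReal in
lemma tsum_starsum (w : ℕ → ℕ → ℝ≥0∞) (d : ℕ) : ∀ f : ℕ → ℝ≥0∞,
    ∑' g : Fin d → ℕ, (∏ i : Fin d, w i (idxSeq g i)) * f (1 + ∑ i, g i) = ∑' N, Acoef w d N * f N := by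
  induction d with
  | zero =>
    intro f
    rw [tsum_fintype, tsum_eq_single 1]
    · simp [Acoef]
    · intro N hN; simp [Acoef, hN]
  | succ d ih =>
    intro f
    rw [← (Fin.snocEquiv (fun _ : Fin (d + 1) => ℕ)).tsum_eq]
    rw [ENNReal.tsum_prod', ENNReal.tsum_comm]
    have e1 : ∀ g : Fin d → ℕ, ∑' x : ℕ, (∏ i : Fin (d + 1), w i (idxSeq (Fin.snocEquiv (fun _ : Fin (d + 1) => ℕ) (x, g)) i)) *
        f (1 + ∑ i, (Fin.snocEquiv (fun _ : Fin (d + 1) => ℕ) (x, g)) i) =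
        (∏ i : Fin d, w i (idxSeq g i)) * (fun M => ∑' x, w d (M + x) * f (M + x)) (1 + ∑ i, g i) := by
      intro g
      rw [← ENNReal.tsum_mul_left]
      refine tsum_congr fun x => ?_
      have h0 : Fin.snocEquiv (fun _ : Fin (d + 1) => ℕ) (x, g) = (Fin.snoc g x : Fin (d + 1) → ℕ) := rfl
      rw [h0, Fin.prod_univ_castSucc, Fin.sum_univ_castSucc]
      simp only [idxSeq_snoc_castSucc, idxSeq_snoc_last]
      simp [mul_assoc, add_assoc]
    rw [tsum_congr e1, ih (fun M => ∑' x, w d (M + x) * f (M + x))]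
    have e2 := tsum_conv (Acoef w d) (fun N => w d N * f N)
    simp_rw [ENNReal.tsum_mul_left] at e2
    rw [e2]
    refine tsum_congr fun N => ?_
    rw [Acoef]; ring

lemma Ssum_nonneg (e : ℕ → ℕ) (d N : ℕ) : 0 ≤ Ssum e d N := by
  induction d generalizing N with
  | zero => simp [Ssum]
  | succ d ih => rw [Ssum]; exact Finset.sum_nonneg fun M _ => div_nonneg (ih _) (by positivity)

lemma Acoef_sum (e : ℕ → ℕ) (he : ∀ i, e i ≠ 0) (d N : ℕ) (hN : 1 ≤ N ∨ 1 ≤ d) :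
    ∑ M ∈ Finset.range (N + 1), Acoef (fun i n => ENNReal.ofReal (1 / (n : ℝ) ^ e i)) d M
      = ENNReal.ofReal (Ssum e d N) := by
  induction d generalizing N with
  | zero =>
    have hN' : 1 ≤ N := by omega
    simp [Acoef, Ssum]; omega
  | succ d ih =>
    rw [Finset.sum_range_succ', Acoef]
    have h0 : ENNReal.ofReal (1 / ((0 : ℕ) : ℝ) ^ e d) = 0 := by simp [he d]
    rw [h0, zero_mul, add_zero, Ssum, ENNReal.ofReal_sum_of_nonneg]
    · refine Finset.sum_congr rfl fun M _ => ?_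
      rw [Acoef, ih _ (by omega), ← ENNReal.ofReal_mul (by positivity)]
      congr 1
      push_cast
      ring
    · intro M _; exact div_nonneg (Ssum_nonneg _ _ _) (by positivity)

lemma zetaStar_eq_of_tendsto (e : ℕ → ℕ) (he : ∀ i, e i ≠ 0) (d : ℕ) (s : Fin d → ℕ) (hs : ∀ i, s i = e i)
    (hd : 1 ≤ d) (l : ℝ) (hl : Filter.Tendsto (fun N => Ssum e d N) Filter.atTop (nhds l)) :
    zetaStar s = l := by
  have hl0 : 0 ≤ l := ge_of_tendsto' hl fun N => Ssum_nonneg _ _ _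
  set w : ℕ → ℕ → ENNReal := fun i n => ENNReal.ofReal (1 / (n : ℝ) ^ e i) with hw
  have h1 : zetaStar s = (∑' g : Fin d → ℕ, ∏ i : Fin d, w i (idxSeq g i)).toReal := by
    rw [ENNReal.tsum_toReal_eq]
    · rw [zetaStar]
      refine tsum_congr fun g => ?_
      rw [ENNReal.toReal_prod]
      refine Finset.prod_congr rfl fun i _ => ?_
      rw [hw, ENNReal.toReal_ofReal (by positivity), hs]
    · intro g
      exact ENNReal.prod_ne_top fun i _ => ENNReal.ofReal_ne_top
  have h2 := tsum_starsum w d (fun _ => 1)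
  simp only [mul_one] at h2
  rw [h1, h2]
  have h3 : Filter.Tendsto (fun N => ∑ M ∈ Finset.range (N + 1), Acoef w d M) Filter.atTop
      (nhds (∑' N, Acoef w d N)) :=
    (ENNReal.tendsto_nat_tsum _).comp (Filter.tendsto_add_atTop_nat 1)
  have h4 : Filter.Tendsto (fun N => ∑ M ∈ Finset.range (N + 1), Acoef w d M) Filter.atTop
      (nhds (ENNReal.ofReal l)) := by
    have := (ENNReal.continuous_ofReal.tendsto l).comp hl
    refine this.congr fun N => ?_
    rw [Acoef_sum e he d N (Or.inr hd)]; rfl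
  rw [tendsto_nhds_unique h3 h4, ENNReal.toReal_ofReal hl0]

lemma zetaStar_eq_tsum (r : ℕ) : zetaStar (Fin.cons 2 (Fin.cons 3 (pat13 r))) =
    -2 * ∑' k, (MLop^[2 * r + 1] cube) k := by
  refine zetaStar_eq_of_tendsto expo (fun i => by unfold expo; split_ifs <;> simp) (2 * r + 2) _ ?_ (by omega) _ (Ssum_tendsto r)
  intro i
  refine Fin.cases ?_ (fun i => ?_) i
  · simp [expo]
  · refine Fin.cases ?_ (fun i => ?_) i
    · simp [expo]
    · simp only [Fin.cons_succ, pat13, expo, Fin.val_succ]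
      have : (i : ℕ) % 2 = 0 ∨ (i : ℕ) % 2 = 1 := Nat.mod_two_eq_zero_or_one _
      rcases this with h | h <;> simp [h] <;> omega

/-! ### Partial fractions -/

lemma pfrac_aux {F : Type*} [Field F] (v : ℕ → F) (s : Finset ℕ) (hv : Set.InjOn v s) :
    (∀ y : F, (∀ j ∈ s, v j ≠ y) → ∏ j ∈ s, (v j + y) / (v j - y) =
      1 + ∑ n ∈ s, 2 * (∏ j ∈ s.erase n, (v j + v n) / (v j - v n)) * (y / (v n - y))) ∧
    ∑ n ∈ s, 2 * (∏ j ∈ s.erase n, (v j + v n) / (v j - v n)) = 1 - (-1) ^ s.card := by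
  classical
  induction s using Finset.induction_on with
  | empty => simp
  | insert a s ha ih =>
    have hv' : Set.InjOn v s := hv.mono (by simp)
    obtain ⟨ih1, ih2⟩ := ih hv'
    have hne : ∀ j ∈ s, v j ≠ v a := by
      intro j hj h
      have := hv (by simp [hj]) (by simp) h
      exact ha (this ▸ hj)
    have ha1 := ih1 (v a) hne
    have e1 : (insert a s).erase a = s := Finset.erase_insert ha
    have e2 : ∀ n ∈ s, ∏ j ∈ (insert a s).erase n, (v j + v n) / (v j - v n) =
        (v a + v n) / (v a - v n) * ∏ j ∈ s.erase n, (v j + v n) / (v j - v n) := by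
      intro n hn
      have : n ≠ a := fun h => ha (h ▸ hn)
      rw [Finset.erase_insert_of_ne this.symm, Finset.prod_insert (by simp [ha])]
    constructor
    · intro y hy
      have hay : v a - y ≠ 0 := sub_ne_zero.mpr (hy a (by simp))
      have hsy : ∀ j ∈ s, v j ≠ y := fun j hj => hy j (by simp [hj])
      rw [Finset.prod_insert ha, Finset.sum_insert ha, ih1 y hsy, e1, ha1]
      have e3 : ∀ n ∈ s, 2 * (∏ j ∈ (insert a s).erase n, (v j + v n) / (v j - v n)) * (y / (v n - y))
         = (v a + y) / (v a - y) * (2 * (∏ j ∈ s.erase n, (v j + v n) / (v j - v n)) * (y / (v n - y)))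
           - 2 * (y / (v a - y)) * (2 * (∏ j ∈ s.erase n, (v j + v n) / (v j - v n)) * (v a / (v n - v a))) := by
        intro n hn
        rw [e2 n hn]
        generalize ∏ j ∈ s.erase n, (v j + v n) / (v j - v n) = q
        have h1 : v n - y ≠ 0 := sub_ne_zero.mpr (hsy n hn)
        have h2 : v n - v a ≠ 0 := sub_ne_zero.mpr (hne n hn)
        have h3 : v a - v n ≠ 0 := sub_ne_zero.mpr (hne n hn).symm
        field_simp
        ring
      rw [Finset.sum_congr rfl e3, Finset.sum_sub_distrib, ← Finset.mul_sum, ← Finset.mul_sum]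
      generalize ∑ n ∈ s, 2 * (∏ j ∈ s.erase n, (v j + v n) / (v j - v n)) * (y / (v n - y)) = A
      generalize ∑ n ∈ s, 2 * (∏ j ∈ s.erase n, (v j + v n) / (v j - v n)) * (v a / (v n - v a)) = B
      field_simp
      ring
    · rw [Finset.sum_insert ha, e1, ha1, Finset.card_insert_of_notMem ha]
      have e3 : ∀ n ∈ s, 2 * (∏ j ∈ (insert a s).erase n, (v j + v n) / (v j - v n))
         = -(2 * (∏ j ∈ s.erase n, (v j + v n) / (v j - v n)))
           - 2 * (2 * (∏ j ∈ s.erase n, (v j + v n) / (v j - v n)) * (v a / (v n - v a))) := by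
        intro n hn
        rw [e2 n hn]
        generalize ∏ j ∈ s.erase n, (v j + v n) / (v j - v n) = q
        have h2 : v n - v a ≠ 0 := sub_ne_zero.mpr (hne n hn)
        have h3 : v a - v n ≠ 0 := sub_ne_zero.mpr (hne n hn).symm
        field_simp
        ring
      rw [Finset.sum_congr rfl e3, Finset.sum_sub_distrib, ← Finset.mul_sum, Finset.sum_neg_distrib, ih2, pow_succ]
      ring

noncomputable def tt (j : ℕ) : ℝ := (-1) ^ j * (j : ℝ) ^ 2

noncomputable def PiK (K n : ℕ) : ℝ := ∏ j ∈ (Finset.Icc 1 K).erase n, (tt j + tt n) / (tt j - tt n)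

noncomputable def SS (n : ℕ) : ℝ := (-1) ^ n * TT n ((n : ℝ) ^ 2) n

noncomputable def ell (n k : ℕ) : ℝ :=
  if k = 0 then 0 else QQ n ((n : ℝ) ^ 2) k + QQ n ((n : ℝ) ^ 2) (k - 1)

lemma abs_tt (j : ℕ) : |tt j| = (j : ℝ) ^ 2 := by
  rw [tt, abs_mul, abs_pow, abs_neg, abs_one, one_pow, one_mul, abs_pow, Nat.abs_cast]

lemma tt_inj {i j : ℕ} (h : |tt i| = |tt j|) : i = j := by
  rw [abs_tt, abs_tt] at h
  have h2 : i ^ 2 = j ^ 2 := by exact_mod_cast h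
  exact Nat.pow_left_injective (n := 2) (by norm_num) h2

lemma tt_add_ne {i j : ℕ} (hj : j ≠ 0) : tt i + tt j ≠ 0 := by
  intro h
  have h1 : tt i = - tt j := by linarith
  have h2 : i = j := tt_inj (by rw [h1, abs_neg])
  subst h2
  have h3 : tt i = 0 := by linarith
  have := abs_tt i
  rw [h3, abs_zero] at this
  have h4 : (i : ℝ) ^ 2 ≠ 0 := by positivity
  exact h4 this.symm

lemma tt_sub_ne {i j : ℕ} (h : i ≠ j) : tt i - tt j ≠ 0 := by
  intro h'
  exact h (tt_inj (by rw [sub_eq_zero.mp h']))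

lemma tt_ne {j : ℕ} (hj : j ≠ 0) : tt j ≠ 0 := by
  have := abs_tt j
  intro h
  rw [h, abs_zero] at this
  have h4 : (j : ℝ) ^ 2 ≠ 0 := by positivity
  exact h4 this.symm

lemma mu_eq (j : ℕ) : mu j = 1 / tt j := by
  rw [mu, tt]
  rcases Nat.even_or_odd j with h | h
  · simp [h.neg_one_pow]
  · simp [h.neg_one_pow]; ring

lemma factor_eq (k n : ℕ) (hn : n ≠ 0) :
    (if Even (k + n) then (((k : ℕ) : ℝ) ^ 2 - n ^ 2) / (((k : ℕ) : ℝ) ^ 2 + (n : ℝ) ^ 2)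
      else (((k : ℕ) : ℝ) ^ 2 + (n : ℝ) ^ 2) / (((k : ℕ) : ℝ) ^ 2 - n ^ 2)) = (tt k - tt n) / (tt k + tt n) := by
  rw [tt, tt]
  rcases Nat.even_or_odd k with h | h <;> rcases Nat.even_or_odd n with h' | h'
  · rw [if_pos (h.add h'), h.neg_one_pow, h'.neg_one_pow]; ring
  · rw [if_neg (by simpa using h.add_odd h'), h.neg_one_pow, h'.neg_one_pow]; ring
  · rw [if_neg (by simpa using h.add_even h'), h.neg_one_pow, h'.neg_one_pow]
    rw [← neg_div_neg_eq]; ring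
  · rw [if_pos (h.add_odd h'), h.neg_one_pow, h'.neg_one_pow]
    rw [← neg_div_neg_eq]; ring

lemma QQ_succ' (n k : ℕ) (hn : n ≠ 0) :
    QQ n ((n : ℝ) ^ 2) (k + 1) * (tt (k + 1) + tt n) = QQ n ((n : ℝ) ^ 2) k * (tt (k + 1) - tt n) := by
  rw [QQ, factor_eq (k + 1) n hn]
  have := tt_add_ne (i := k + 1) hn
  field_simp

lemma QQ_zero_of_ge (n k : ℕ) (hn : n ≠ 0) (h : n ≤ k) : QQ n ((n : ℝ) ^ 2) k = 0 := by
  induction k, h using Nat.le_induction with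
  | base =>
    obtain ⟨k, rfl⟩ : ∃ k, n = k + 1 := ⟨n - 1, by omega⟩
    rw [QQ]; simp
  | succ k hk ih => rw [QQ, ih, zero_mul]

lemma ell_mu (n k : ℕ) (hn : n ≠ 0) :
    ell n (k + 1) * mu (k + 1) = - mu n * (QQ n ((n : ℝ) ^ 2) (k + 1) - QQ n ((n : ℝ) ^ 2) k) := by
  have := QQ_succ' n k hn
  rw [mu_eq, mu_eq, ell, if_neg (by omega), Nat.add_sub_cancel]
  have h1 := tt_ne hn
  have h2 := tt_ne (j := k + 1) (by omega)
  field_simp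
  linarith

lemma ell_MLop (n : ℕ) (hn : n ≠ 0) (f : ℕ → ℝ) (hf : f 0 = 0) (K : ℕ) (hK : n ≤ K) :
    ∑ k ∈ Finset.range (K + 1), ell n k * MLop f k = mu n * ∑ k ∈ Finset.range (K + 1), ell n k * f k := by
  have key : ∀ K, ∑ k ∈ Finset.range (K + 1), ell n k * MLop f k =
    mu n * (∑ k ∈ Finset.range (K + 1), ell n k * f k
     - 2 * QQ n ((n : ℝ) ^ 2) K * ∑ i ∈ Finset.range (K + 1), f i) := by
    intro K
    induction K with
    | zero => simp [ell, hf]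
    | succ K ih =>
      rw [Finset.sum_range_succ, ih, Finset.sum_range_succ _ (K + 1), Finset.sum_range_succ f (K + 1),
        MLop, ← mul_assoc, ell_mu n K hn, LL, ell, if_neg (by omega), Nat.add_sub_cancel]
      ring
  rw [key, QQ_zero_of_ge n K hn hK]; ring

lemma ell_iter (n : ℕ) (hn : n ≠ 0) (K : ℕ) (hK : n ≤ K) (m : ℕ) :
    ∑ k ∈ Finset.range (K + 1), ell n k * (MLop^[m] cube) k =
      mu n ^ m * ∑ k ∈ Finset.range (K + 1), ell n k * cube k := by
  induction m with
  | zero => simp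
  | succ m ih =>
    rw [Function.iterate_succ_apply', ell_MLop n hn _ ?_ K hK, ih, pow_succ]
    · ring
    · cases m with
      | zero => simp [cube_zero]
      | succ m => rw [Function.iterate_succ_apply', MLop_zero]

lemma ell_cube (n : ℕ) (hn : n ≠ 0) (K : ℕ) (hK : n ≤ K) :
    ∑ k ∈ Finset.range (K + 1), ell n k * cube k = - mu n * SS n := by
  have key : ∀ K, ∑ k ∈ Finset.range (K + 1), ell n k * cube k =
     - mu n * ((-1) ^ n * TT n ((n : ℝ) ^ 2) K) := by
    intro K
    induction K with
    | zero => simp [ell, TT]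
    | succ K ih =>
      rw [Finset.sum_range_succ, ih, TT]
      have h1 : cube (K + 1) = mu (K + 1) * ((-1) ^ (K + 1) / ((K + 1 : ℕ) : ℝ)) := by
        rw [cube, mu]
        rw [show ((-1 : ℝ) ^ (K + 1) / ((K + 1 : ℕ) : ℝ) ^ 2 * ((-1) ^ (K + 1) / ((K + 1 : ℕ) : ℝ)))
          = ((-1 : ℝ) ^ (K + 1) * (-1) ^ (K + 1)) / ((K + 1 : ℕ) : ℝ) ^ 3 by ring, neg_one_sq']
      rw [h1, ← mul_assoc (ell n (K + 1)), ell_mu n K hn]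
      have h2 : (-1 : ℝ) ^ n * (if Even (K + 1 + n) then (1 : ℝ) else -1) = (-1) ^ (K + 1) := by
        have : (if Even (K + 1 + n) then (1 : ℝ) else -1) = (-1) ^ (K + 1 + n) := by
          split_ifs with h
          · rw [h.neg_one_pow]
          · rw [(Nat.not_even_iff_odd.mp h).neg_one_pow]
        rw [this, pow_add]
        rw [show (-1 : ℝ) ^ n * ((-1) ^ (K + 1) * (-1) ^ n) = ((-1) ^ n * (-1) ^ n) * (-1) ^ (K + 1) by ring, neg_one_sq', one_mul]
      rw [← h2]
      ring
  have h0 : ∀ K, n ≤ K → TT n ((n : ℝ) ^ 2) K = TT n ((n : ℝ) ^ 2) n := by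
    intro K hK
    induction K, hK using Nat.le_induction with
    | base => rfl
    | succ K hK ih => rw [TT, ih, QQ_zero_of_ge n _ hn (by omega), QQ_zero_of_ge n _ hn hK]; simp
  rw [key, h0 K hK, SS]

lemma PiK_QQ (K n k : ℕ) (hn : n ≠ 0) (hkK : k ≤ K) (hkn : k < n) :
    PiK K n * QQ n ((n : ℝ) ^ 2) k = ∏ j ∈ (Finset.Icc (k + 1) K).erase n, (tt j + tt n) / (tt j - tt n) := by
  induction k with
  | zero => simp [PiK, QQ]
  | succ k ih =>
    have ih := ih (by omega) (by omega)
    have e : (Finset.Icc (k + 1) K).erase n = insert (k + 1) ((Finset.Icc (k + 1 + 1) K).erase n) := by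
      ext x; simp only [Finset.mem_erase, Finset.mem_Icc, Finset.mem_insert]; omega
    rw [e, Finset.prod_insert (by simp)] at ih
    have h1 := QQ_succ' n k hn
    have h2 := tt_add_ne (i := k + 1) hn
    have h3 := tt_sub_ne (i := k + 1) (j := n) (by omega)
    have h4 : QQ n ((n : ℝ) ^ 2) (k + 1) = QQ n ((n : ℝ) ^ 2) k * ((tt (k + 1) - tt n) / (tt (k + 1) + tt n)) := by
      field_simp; linarith
    rw [h4, ← mul_assoc, ih]
    field_simp

lemma sum_PiK_QQ (K k : ℕ) (hk : k ≤ K) :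
    ∑ n ∈ Finset.Icc 1 K, PiK K n * QQ n ((n : ℝ) ^ 2) k = (1 - (-1) ^ (K - k)) / 2 := by
  have h1 : ∑ n ∈ Finset.Icc 1 K, PiK K n * QQ n ((n : ℝ) ^ 2) k =
      ∑ n ∈ Finset.Icc (k + 1) K, PiK K n * QQ n ((n : ℝ) ^ 2) k := by
    symm
    refine Finset.sum_subset (Finset.Icc_subset_Icc (by omega) le_rfl) fun n hn hn' => ?_
    simp only [Finset.mem_Icc] at hn hn'
    rw [QQ_zero_of_ge n k (by omega) (by omega), mul_zero]
  rw [h1]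
  have h2 := (pfrac_aux tt (Finset.Icc (k + 1) K) (fun i _ j _ h => tt_inj (by rw [h]))).2
  rw [← Finset.mul_sum] at h2
  have h3 : (Finset.Icc (k + 1) K).card = K - k := by simp
  rw [h3] at h2
  rw [← h2]
  rw [mul_div_cancel_left₀ _ (by norm_num)]
  refine Finset.sum_congr rfl fun n hn => ?_
  simp only [Finset.mem_Icc] at hn
  rw [PiK_QQ K n k (by omega) hk (by omega)]

lemma sum_PiK_ell (K k : ℕ) (hk : k + 1 ≤ K) : ∑ n ∈ Finset.Icc 1 K, PiK K n * ell n (k + 1) = 1 := by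
  have h : ∀ n, ell n (k + 1) = QQ n ((n : ℝ) ^ 2) (k + 1) + QQ n ((n : ℝ) ^ 2) k := by
    intro n; rw [ell, if_neg (by omega), Nat.add_sub_cancel]
  simp only [h, mul_add]
  rw [Finset.sum_add_distrib, sum_PiK_QQ _ _ hk, sum_PiK_QQ _ _ (by omega)]
  rw [show K - k = K - (k + 1) + 1 by omega, pow_succ]
  ring

lemma sum_iter (K m : ℕ) : ∑ k ∈ Finset.range (K + 1), (MLop^[m] cube) k =
    - ∑ n ∈ Finset.Icc 1 K, PiK K n * (mu n ^ (m + 1) * SS n) := by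
  have h0 : (MLop^[m] cube) 0 = 0 := by
    cases m with
    | zero => simp [cube_zero]
    | succ m => rw [Function.iterate_succ_apply', MLop_zero]
  have h1 : ∀ k ∈ Finset.range (K + 1), (MLop^[m] cube) k =
      ∑ n ∈ Finset.Icc 1 K, PiK K n * (ell n k * (MLop^[m] cube) k) := by
    intro k hk
    rw [Finset.mem_range] at hk
    cases k with
    | zero => simp [h0]
    | succ k =>
      simp only [← mul_assoc]
      rw [← Finset.sum_mul, sum_PiK_ell K k (by omega), one_mul]
  rw [Finset.sum_congr rfl h1, Finset.sum_comm, ← Finset.sum_neg_distrib]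
  refine Finset.sum_congr rfl fun n hn => ?_
  simp only [Finset.mem_Icc] at hn
  rw [← Finset.mul_sum, ell_iter n (by omega) K hn.2, ell_cube n (by omega) K hn.2]
  ring

/-! ### Bounds and the limit -/

/-- sequential version of `PiK` -/
noncomputable def PP (n K : ℕ) : ℝ :=
  ∏ j ∈ Finset.range K, (if j + 1 = n then 1 else (tt (j + 1) + tt n) / (tt (j + 1) - tt n))

lemma PiK_eq_PP (K n : ℕ) : PiK K n = PP n K := by
  rw [PP, PiK]
  have h : Finset.Icc 1 K = (Finset.range K).map ⟨fun j => j + 1, fun a b h => by simpa using h⟩ := by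
    ext x; simp only [Finset.mem_Icc, Finset.mem_map, Finset.mem_range]
    constructor
    · intro h; exact ⟨x - 1, by omega, by change x - 1 + 1 = x; omega⟩
    · rintro ⟨a, ha, rfl⟩; change 1 ≤ a + 1 ∧ a + 1 ≤ K; omega
  have h2 : ∏ j ∈ Finset.Icc 1 K, (if j = n then 1 else (tt j + tt n) / (tt j - tt n)) =
    ∏ j ∈ Finset.range K, (if j + 1 = n then 1 else (tt (j + 1) + tt n) / (tt (j + 1) - tt n)) := by
    rw [h, Finset.prod_map]; rfl
  rw [← h2]
  have h3 : ∏ j ∈ (Finset.Icc 1 K).erase n, (tt j + tt n) / (tt j - tt n) =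
    ∏ j ∈ (Finset.Icc 1 K).erase n, (if j = n then 1 else (tt j + tt n) / (tt j - tt n)) := by
    refine Finset.prod_congr rfl fun j hj => ?_
    rw [if_neg (Finset.ne_of_mem_erase hj)]
  rw [h3]
  by_cases hn : n ∈ Finset.Icc 1 K
  · rw [← Finset.mul_prod_erase _ _ hn]; simp
  · rw [Finset.erase_eq_of_notMem hn]

lemma fac_abs_even (j n : ℕ) (h : Even (j + n)) :
    |(tt j + tt n) / (tt j - tt n)| = ((j : ℝ) ^ 2 + n ^ 2) / |(j : ℝ) ^ 2 - n ^ 2| := by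
  rw [abs_div, tt, tt]
  rcases Nat.even_or_odd n with h' | h'
  · have h2 : Even j := by
      rcases Nat.even_or_odd j with h3 | h3
      · exact h3
      · exact absurd h (by simpa using h3.add_even h')
    rw [h'.neg_one_pow, h2.neg_one_pow, one_mul, one_mul, abs_of_nonneg (a := (j : ℝ) ^ 2 + n ^ 2) (by positivity)]
  · have h2 : Odd j := by
      rcases Nat.even_or_odd j with h3 | h3
      · exact absurd h (by simpa using h3.add_odd h')
      · exact h3
    rw [h'.neg_one_pow, h2.neg_one_pow]
    rw [show (-1 : ℝ) * (j : ℝ) ^ 2 + -1 * (n : ℝ) ^ 2 = -((j : ℝ) ^ 2 + n ^ 2) by ring,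
      show (-1 : ℝ) * (j : ℝ) ^ 2 - -1 * (n : ℝ) ^ 2 = -((j : ℝ) ^ 2 - n ^ 2) by ring, abs_neg, abs_neg,
      abs_of_nonneg (a := (j : ℝ) ^ 2 + n ^ 2) (by positivity)]

lemma fac_abs_odd (j n : ℕ) (h : ¬ Even (j + n)) :
    |(tt j + tt n) / (tt j - tt n)| = |(j : ℝ) ^ 2 - n ^ 2| / ((j : ℝ) ^ 2 + n ^ 2) := by
  rw [abs_div, tt, tt]
  rcases Nat.even_or_odd n with h' | h'
  · have h2 : Odd j := by
      rcases Nat.even_or_odd j with h3 | h3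
      · exact absurd (h3.add h') h
      · exact h3
    rw [h'.neg_one_pow, h2.neg_one_pow]
    rw [show (-1 : ℝ) * (j : ℝ) ^ 2 + 1 * (n : ℝ) ^ 2 = -((j : ℝ) ^ 2 - n ^ 2) by ring,
      show (-1 : ℝ) * (j : ℝ) ^ 2 - 1 * (n : ℝ) ^ 2 = -((j : ℝ) ^ 2 + n ^ 2) by ring, abs_neg, abs_neg,
      abs_of_nonneg (a := (j : ℝ) ^ 2 + n ^ 2) (by positivity)]
  · have h2 : Even j := by
      rcases Nat.even_or_odd j with h3 | h3
      · exact h3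
      · exact absurd (h3.add_odd h') h
    rw [h'.neg_one_pow, h2.neg_one_pow]
    rw [show (1 : ℝ) * (j : ℝ) ^ 2 + -1 * (n : ℝ) ^ 2 = ((j : ℝ) ^ 2 - n ^ 2) by ring,
      show (1 : ℝ) * (j : ℝ) ^ 2 - -1 * (n : ℝ) ^ 2 = ((j : ℝ) ^ 2 + n ^ 2) by ring,
      abs_of_nonneg (a := (j : ℝ) ^ 2 + n ^ 2) (by positivity)]

lemma PP_bound_aux (n : ℕ) (hn : n ≠ 0) (k : ℕ) :
    (k < n → ¬ Even (k + n) → |PP n k| ≤ 1) ∧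
    (k < n → Even (k + n) → |PP n k| * ((n : ℝ) ^ 2 - k ^ 2) ≤ (n : ℝ) ^ 2 + k ^ 2) ∧
    (n ≤ k → Even (k + n) → |PP n k| ≤ 1) ∧
    (n ≤ k → ¬ Even (k + n) → |PP n k| * ((k : ℝ) ^ 2 + n ^ 2) ≤ (k : ℝ) ^ 2 - n ^ 2) := by
  induction k with
  | zero =>
    refine ⟨fun _ _ => by simp [PP], fun _ _ => by simp [PP], fun h => absurd h (by omega), fun h => absurd h (by omega)⟩
  | succ k ih =>
    have hn0 : (0 : ℝ) < n := by positivity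
    have hk0 : (0 : ℝ) ≤ k := Nat.cast_nonneg k
    have hP : |PP n (k + 1)| = |PP n k| * |if k + 1 = n then 1 else (tt (k + 1) + tt n) / (tt (k + 1) - tt n)| := by
      rw [PP, Finset.prod_range_succ, PP, abs_mul]
    obtain ⟨i1, i2, i3, i4⟩ := ih
    have hpos := abs_nonneg (PP n k)
    generalize |PP n k| = p at *
    refine ⟨fun h e => ?_, fun h e => ?_, fun h e => ?_, fun h e => ?_⟩
    · have e' := even_aux' _ _ e
      have hkn : (k : ℝ) + 1 < n := by exact_mod_cast h
      rw [hP, if_neg (by omega), fac_abs_odd _ _ e]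
      have i := i2 (by omega) e'
      push_cast
      rw [abs_of_neg (by nlinarith), ← mul_div_assoc, div_le_one (by positivity)]
      have h1 : p * ((n : ℝ) ^ 2 - k ^ 2) * (-((k + 1) ^ 2 - (n : ℝ) ^ 2)) ≤
        ((n : ℝ) ^ 2 + k ^ 2) * (-((k + 1) ^ 2 - (n : ℝ) ^ 2)) := mul_le_mul_of_nonneg_right i (by nlinarith)
      have h2 : (0 : ℝ) < (n : ℝ) ^ 2 - k ^ 2 := by nlinarith
      have h3 : ((n : ℝ) ^ 2 + k ^ 2) * (-((k + 1) ^ 2 - (n : ℝ) ^ 2)) ≤ ((k + 1) ^ 2 + (n : ℝ) ^ 2) * ((n : ℝ) ^ 2 - k ^ 2) := by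
        nlinarith [sq_nonneg (n : ℝ)]
      have h4 : (p * (-((k + 1) ^ 2 - (n : ℝ) ^ 2))) * ((n : ℝ) ^ 2 - k ^ 2) ≤ ((k + 1) ^ 2 + (n : ℝ) ^ 2) * ((n : ℝ) ^ 2 - k ^ 2) := by
        linarith
      exact le_of_mul_le_mul_right h4 h2
    · have e' := even_aux _ _ e
      have hkn : (k : ℝ) + 1 < n := by exact_mod_cast h
      rw [hP, if_neg (by omega), fac_abs_even _ _ e]
      have i := i1 (by omega) e'
      push_cast
      have h2 : (0 : ℝ) < (n : ℝ) ^ 2 - (k + 1) ^ 2 := by nlinarith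
      rw [abs_of_neg (by linarith), mul_assoc, div_mul_eq_mul_div, neg_sub, mul_div_cancel_right₀ _ h2.ne']
      nlinarith [sq_nonneg (n : ℝ), sq_nonneg ((k : ℝ) + 1)]
    · by_cases hk : k + 1 = n
      · rw [hP, if_pos hk, abs_one, mul_one]
        exact i1 (by omega) (even_aux _ _ e)
      · have e' := even_aux _ _ e
        have hkn : (n : ℝ) ≤ k := by exact_mod_cast (by omega : n ≤ k)
        rw [hP, if_neg hk, fac_abs_even _ _ e]
        have i := i4 (by omega) e'
        push_cast
        have h2 : (0 : ℝ) < (k + 1) ^ 2 - (n : ℝ) ^ 2 := by nlinarith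
        rw [abs_of_pos h2, ← mul_div_assoc, div_le_one h2]
        have h1 : p * ((k : ℝ) ^ 2 + n ^ 2) * ((k + 1) ^ 2 + (n : ℝ) ^ 2) ≤
          ((k : ℝ) ^ 2 - n ^ 2) * ((k + 1) ^ 2 + (n : ℝ) ^ 2) := mul_le_mul_of_nonneg_right i (by positivity)
        have h3 : ((k : ℝ) ^ 2 - n ^ 2) * ((k + 1) ^ 2 + (n : ℝ) ^ 2) ≤ ((k + 1) ^ 2 - (n : ℝ) ^ 2) * ((k : ℝ) ^ 2 + n ^ 2) := by
          nlinarith [sq_nonneg (n : ℝ), mul_nonneg hk0 (sq_nonneg (n : ℝ))]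
        have h4 : (p * ((k + 1) ^ 2 + (n : ℝ) ^ 2)) * ((k : ℝ) ^ 2 + n ^ 2) ≤ ((k + 1) ^ 2 - (n : ℝ) ^ 2) * ((k : ℝ) ^ 2 + n ^ 2) := by
          linarith
        exact le_of_mul_le_mul_right h4 (add_pos_of_nonneg_of_pos (sq_nonneg _) (pow_pos hn0 2))
    · have hk : k + 1 ≠ n := by
        rintro rfl
        exact e (by rw [Nat.even_iff]; omega)
      have e' := even_aux' _ _ e
      have hkn : (n : ℝ) ≤ k := by exact_mod_cast (by omega : n ≤ k)
      rw [hP, if_neg hk, fac_abs_odd _ _ e]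
      have i := i3 (by omega) e'
      push_cast
      have h2 : (0 : ℝ) < (k + 1) ^ 2 - (n : ℝ) ^ 2 := by nlinarith
      rw [abs_of_pos h2, mul_assoc, div_mul_cancel₀ _ (by positivity)]
      nlinarith

lemma PP_bound (n : ℕ) (hn : n ≠ 0) (k : ℕ) (hk : n ≤ k) : |PP n k| ≤ 1 := by
  obtain ⟨-, -, h3, h4⟩ := PP_bound_aux n hn k
  by_cases e : Even (k + n)
  · exact h3 hk e
  · have h := h4 hk e
    have hn0 : (0 : ℝ) < n := by positivity
    have : |PP n k| * ((k : ℝ) ^ 2 + n ^ 2) ≤ 1 * ((k : ℝ) ^ 2 + n ^ 2) := by nlinarith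
    exact le_of_mul_le_mul_right this (by positivity)

lemma PP_tendsto (n : ℕ) : ∃ l, Filter.Tendsto (fun K => PP n K) Filter.atTop (nhds l) := by
  set f : ℕ → ℝ := fun j => (if j + 1 = n then 1 else (tt (j + 1) + tt n) / (tt (j + 1) - tt n)) - 1 with hf
  have hs : Summable (fun j => ‖f j‖) := by
    have h1 : Summable (fun j : ℕ => 4 * (n : ℝ) ^ 2 * (1 / ((j + 1 : ℕ) : ℝ) ^ 2)) :=
      ((summable_nat_add_iff 1).mpr (Real.summable_one_div_nat_pow.mpr (by norm_num : 1 < 2))).mul_left _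
    refine (Summable.of_norm_bounded_eventually_nat h1 ?_)
    filter_upwards [Filter.eventually_ge_atTop (2 * n)] with j hj
    have hj' : 2 * (n : ℝ) ≤ j := by exact_mod_cast hj
    have hn0 : (0 : ℝ) ≤ n := Nat.cast_nonneg n
    rw [norm_norm, hf]
    simp only
    rw [if_neg (by omega)]
    have h2 := tt_sub_ne (i := j + 1) (j := n) (by omega)
    have h3 : (tt (j + 1) + tt n) / (tt (j + 1) - tt n) - 1 = 2 * tt n / (tt (j + 1) - tt n) := by
      field_simp; ring
    rw [h3, Real.norm_eq_abs, abs_div, abs_mul, abs_tt, abs_two]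
    have h4 : ((j : ℝ) + 1) ^ 2 / 2 ≤ |tt (j + 1) - tt n| := by
      have := abs_sub_abs_le_abs_sub (tt (j + 1)) (tt n)
      rw [abs_tt, abs_tt] at this
      push_cast at this
      nlinarith
    push_cast
    calc 2 * (n : ℝ) ^ 2 / |tt (j + 1) - tt n| ≤ 2 * (n : ℝ) ^ 2 / (((j : ℝ) + 1) ^ 2 / 2) := by
          gcongr
      _ = 4 * (n : ℝ) ^ 2 * (1 / ((j : ℝ) + 1) ^ 2) := by field_simp; ring
  have hm := multipliable_one_add_of_summable hs
  refine ⟨∏' j, (1 + f j), ?_⟩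
  refine hm.hasProd.tendsto_prod_nat.congr fun K => ?_
  rw [PP]
  exact Finset.prod_congr rfl fun j _ => by simp only [hf]; ring

noncomputable def kap (n : ℕ) : ℝ := Classical.choose (PP_tendsto n)

lemma kap_tendsto (n : ℕ) : Filter.Tendsto (fun K => PP n K) Filter.atTop (nhds (kap n)) :=
  Classical.choose_spec (PP_tendsto n)

lemma kap_bound (n : ℕ) (hn : n ≠ 0) : |kap n| ≤ 1 := by
  refine le_of_tendsto (kap_tendsto n).abs ?_
  filter_upwards [Filter.eventually_ge_atTop n] with K hK
  exact PP_bound n hn K hK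

/-- Tannery for the weights `PiK K n → kap n`. -/
lemma kap_tannery {E : Type*} [NormedAddCommGroup E] [NormedSpace ℝ E] [CompleteSpace E] (x : ℕ → E)
    (hx0 : x 0 = 0) (hx : Summable (fun n => ‖x n‖)) :
    Filter.Tendsto (fun K => ∑ n ∈ Finset.Icc 1 K, PiK K n • x n) Filter.atTop (nhds (∑' n, kap n • x n)) := by
  have h := tendsto_tsum_of_dominated_convergence (𝓕 := Filter.atTop)
    (f := fun K n => if n ∈ Finset.Icc 1 K then PiK K n • x n else 0) (g := fun n => kap n • x n)
    (bound := fun n => ‖x n‖) hx ?_ ?_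
  · refine h.congr fun K => ?_
    rw [tsum_eq_sum (s := Finset.Icc 1 K)]
    · exact Finset.sum_congr rfl fun n hn => by rw [if_pos hn]
    · intro n hn; rw [if_neg hn]
  · intro n
    rcases Nat.eq_zero_or_pos n with rfl | hn
    · simp [hx0]
    · refine ((kap_tendsto n).smul_const (x n)).congr' ?_
      filter_upwards [Filter.eventually_ge_atTop n] with K hK
      rw [if_pos (by simp; omega), PiK_eq_PP]
  · refine Filter.Eventually.of_forall fun K n => ?_
    split_ifs with h
    · simp only [Finset.mem_Icc] at h
      rw [norm_smul, PiK_eq_PP, Real.norm_eq_abs]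
      exact mul_le_of_le_one_left (norm_nonneg _) (PP_bound n (by omega) K h.2)
    · simp

lemma TT_bound (n : ℕ) (hn : n ≠ 0) : |TT n ((n : ℝ) ^ 2) n| ≤ 9 * n := by
  have hw : (0 : ℝ) < (n : ℝ) ^ 2 := by positivity
  rcases Nat.even_or_odd' n with ⟨p, hp | hp⟩
  · obtain ⟨q, rfl⟩ : ∃ q, p = q + 1 := ⟨p - 1, by omega⟩
    have hn' : n = 2 * q + 2 := by omega
    clear hp
    subst hn'
    rw [TT_even q _ hw]
    have hq0 : (0 : ℝ) ≤ q := Nat.cast_nonneg q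
    have h1 : |∑ i ∈ Finset.range (q + 1), 1 / (2 * (i : ℝ) + 1)| ≤ (q + 1) := by
      refine (Finset.abs_sum_le_sum_abs _ _).trans ?_
      refine (Finset.sum_le_card_nsmul _ _ 1 fun i _ => ?_).trans (by simp)
      rw [abs_of_nonneg (by positivity), div_le_one (by positivity)]
      have : (0 : ℝ) ≤ i := Nat.cast_nonneg i
      linarith
    have h2 : |∑ i ∈ Finset.range q, (2 * i + 2) / ((2 * (i : ℝ) + 2) ^ 2 + ((2 * q + 2 : ℕ) : ℝ) ^ 2)| ≤ (q : ℝ) := by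
      refine (Finset.abs_sum_le_sum_abs _ _).trans ?_
      refine (Finset.sum_le_card_nsmul _ _ 1 fun i _ => ?_).trans (by simp)
      rw [abs_of_nonneg (by positivity), div_le_one (by positivity)]
      have : (0 : ℝ) ≤ i := Nat.cast_nonneg i
      nlinarith [sq_nonneg (((2 * q + 2 : ℕ) : ℝ))]
    generalize ∑ i ∈ Finset.range (q + 1), 1 / (2 * (i : ℝ) + 1) = A at *
    generalize ∑ i ∈ Finset.range q, (2 * i + 2) / ((2 * (i : ℝ) + 2) ^ 2 + ((2 * q + 2 : ℕ) : ℝ) ^ 2) = B at *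
    push_cast
    have h3 : ((2 * (q : ℝ) + 2) ^ 2 + (2 * q + 2) ^ 2) * (2 / (2 * q + 2) ^ 2) = 4 := by
      field_simp; ring
    rw [h3]
    have h4 : |(-1 : ℝ) / (2 * q + 2)| ≤ 1 := by
      rw [abs_div, abs_neg, abs_one, abs_of_pos (by positivity), div_le_one (by positivity)]; linarith
    rw [abs_le] at *
    constructor <;> linarith [h1.1, h1.2, h2.1, h2.2, h4.1, h4.2]
  · subst hp
    rw [TT_odd p _ hw]
    have hq0 : (0 : ℝ) ≤ p := Nat.cast_nonneg p
    have h2 : |∑ i ∈ Finset.range p, 2 / ((2 * i + 1) * ((2 * (i : ℝ) + 1) ^ 2 + ((2 * p + 1 : ℕ) : ℝ) ^ 2))| ≤ (p : ℝ) * (2 / (2 * p + 1) ^ 2) := by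
      refine (Finset.abs_sum_le_sum_abs _ _).trans ?_
      refine (Finset.sum_le_card_nsmul _ _ (2 / (2 * (p : ℝ) + 1) ^ 2) fun i _ => ?_).trans (by simp)
      have : (0 : ℝ) ≤ i := Nat.cast_nonneg i
      rw [abs_of_nonneg (by positivity)]
      push_cast
      gcongr
      nlinarith [sq_nonneg (2 * (p : ℝ) + 1), sq_nonneg (2 * (i : ℝ) + 1)]
    generalize ∑ i ∈ Finset.range p, 2 / ((2 * i + 1) * ((2 * (i : ℝ) + 1) ^ 2 + ((2 * p + 1 : ℕ) : ℝ) ^ 2)) = B at *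
    push_cast
    have h4 : |(1 : ℝ) / (2 * p + 1)| ≤ 1 := by
      rw [abs_div, abs_one, abs_of_pos (by positivity), div_le_one (by positivity)]; linarith
    have h5 : |((2 * (p : ℝ) + 1) ^ 2 + (2 * p + 1) ^ 2) * B| ≤ 4 * (p : ℝ) := by
      rw [abs_mul, abs_of_nonneg (by positivity)]
      calc _ ≤ ((2 * (p : ℝ) + 1) ^ 2 + (2 * p + 1) ^ 2) * (p * (2 / (2 * p + 1) ^ 2)) := by gcongr
        _ = 4 * p := by field_simp; ring
    rw [abs_neg]
    refine (abs_add_le _ _).trans ?_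
    linarith

lemma SS_bound (n : ℕ) (hn : n ≠ 0) : |SS n| ≤ 9 * n := by
  rw [SS, abs_mul, abs_pow, abs_neg, abs_one, one_pow, one_mul]
  exact TT_bound n hn

lemma abs_mu (n : ℕ) : |mu n| = 1 / (n : ℝ) ^ 2 := by
  rw [mu, abs_div, abs_pow, abs_neg, abs_one, one_pow, abs_pow, Nat.abs_cast]

lemma abs_mu_le (n : ℕ) : |mu n| ≤ 1 := by
  rw [abs_mu]
  rcases Nat.eq_zero_or_pos n with rfl | h
  · simp
  · rw [div_le_one (by positivity)]
    have : (1 : ℝ) ≤ n := by exact_mod_cast h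
    nlinarith

lemma zetaStar_eq_kap (r : ℕ) : zetaStar (Fin.cons 2 (Fin.cons 3 (pat13 r))) =
    2 * ∑' n, kap n * (mu n ^ (2 * r + 2) * SS n) := by
  rw [zetaStar_eq_tsum]
  have h1 : Filter.Tendsto (fun K => ∑ k ∈ Finset.range (K + 1), (MLop^[2 * r + 1] cube) k) Filter.atTop
      (nhds (∑' k, (MLop^[2 * r + 1] cube) k)) :=
    (summable_iter _).of_abs.hasSum.tendsto_sum_nat.comp (Filter.tendsto_add_atTop_nat 1)
  simp only [sum_iter] at h1
  have h2 := kap_tannery (fun n => mu n ^ (2 * r + 2) * SS n) (by simp [mu_zero]) ?_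
  · simp only [smul_eq_mul] at h2
    rw [tendsto_nhds_unique h1 h2.neg]
    ring
  · have h3 : Summable (fun n : ℕ => 9 * (1 / (n : ℝ) ^ 3)) :=
      (Real.summable_one_div_nat_pow.mpr (by norm_num)).mul_left _
    refine Summable.of_nonneg_of_le (fun _ => norm_nonneg _) (fun n => ?_) h3
    rcases Nat.eq_zero_or_pos n with rfl | h
    · simp [mu_zero]
    · rw [Real.norm_eq_abs, abs_mul, abs_pow, pow_add]
      have h4 := SS_bound n (by omega)
      have h5 : |mu n| ^ (2 * r) ≤ 1 := pow_le_one₀ (abs_nonneg _) (abs_mu_le n)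
      have h6 : (0 : ℝ) < n := by positivity
      calc |mu n| ^ (2 * r) * |mu n| ^ 2 * |SS n| ≤ 1 * |mu n| ^ 2 * (9 * n) := by gcongr
        _ = 9 * (1 / (n : ℝ) ^ 3) := by rw [abs_mu]; field_simp

/-! ### The generating function of the weights -/

/-- The term of the partial fraction expansion -/
noncomputable def qt (y : ℂ) (n : ℕ) : ℂ := 2 * (y * mu n / (1 - y * mu n))

noncomputable def PF (y : ℂ) : ℂ := 1 + ∑' n, (kap n : ℂ) * qt y n

lemma norm_mu (n : ℕ) : ‖(mu n : ℂ)‖ = 1 / (n : ℝ) ^ 2 := by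
  rw [Complex.norm_real, Real.norm_eq_abs, abs_mu]

lemma tt_ne_iff {n : ℕ} (hn : n ≠ 0) {y : ℂ} : 1 - y * mu n ≠ 0 ↔ (tt n : ℂ) ≠ y := by
  have h : (tt n : ℂ) ≠ 0 := by exact_mod_cast tt_ne hn
  rw [mu_eq]; push_cast
  constructor
  · intro h1 h2; apply h1; rw [← h2]; field_simp; simp
  · intro h1 h2; apply h1; field_simp at h2; linear_combination h2

lemma qt_eq {n : ℕ} (hn : n ≠ 0) (y : ℂ) (hy : (tt n : ℂ) ≠ y) : qt y n = 2 * (y / (tt n - y)) := by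
  have h := (tt_ne_iff hn).mpr hy
  rw [qt]
  have h0 : (tt n : ℂ) ≠ 0 := by exact_mod_cast tt_ne hn
  have h1 : (tt n : ℂ) - y ≠ 0 := sub_ne_zero.mpr hy
  rw [mu_eq] at *; push_cast at *
  field_simp

lemma qt_zero (y : ℂ) : qt y 0 = 0 := by simp [qt, mu_zero]

lemma qt_summable (y : ℂ) : Summable (fun n => ‖qt y n‖) := by
  have h3 : Summable (fun n : ℕ => 4 * ‖y‖ * (1 / (n : ℝ) ^ 2)) :=
      (Real.summable_one_div_nat_pow.mpr (by norm_num)).mul_left _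
  have h4 : Filter.Tendsto (fun n : ℕ => ‖y‖ * (1 / (n : ℝ) ^ 2)) Filter.atTop (nhds 0) := by
    have := ((Real.summable_one_div_nat_pow (p := 2)).mpr (by norm_num)).tendsto_atTop_zero.const_mul ‖y‖
    simpa using this
  refine Summable.of_norm_bounded_eventually_nat h3 ?_
  filter_upwards [h4.eventually (gt_mem_nhds (show (0 : ℝ) < 1 / 2 by norm_num))] with n hn
  rw [norm_norm, qt, norm_mul, norm_div, norm_mul, norm_mu]
  have h5 : 1 / 2 ≤ ‖1 - y * (mu n : ℂ)‖ := by
    have := norm_sub_norm_le (1 : ℂ) (y * mu n)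
    rw [norm_one, norm_mul, norm_mu] at this
    linarith
  rw [Complex.norm_ofNat, mul_div_assoc', div_le_iff₀ (by linarith)]
  have h6 : 0 ≤ ‖y‖ * (1 / (n : ℝ) ^ 2) := by positivity
  nlinarith

lemma PF_tendsto (y : ℂ) (hy : ∀ n : ℕ, n ≠ 0 → (tt n : ℂ) ≠ y) :
    Filter.Tendsto (fun K => ∏ j ∈ Finset.Icc 1 K, ((tt j : ℂ) + y) / (tt j - y)) Filter.atTop (nhds (PF y)) := by
  have h := (kap_tannery (qt y) (qt_zero y) (qt_summable y)).const_add 1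
  simp only [Complex.real_smul] at h
  refine h.congr fun K => ?_
  rw [(pfrac_aux (fun j => (tt j : ℂ)) (Finset.Icc 1 K) ?_).1 y ?_]
  · congr 1
    refine Finset.sum_congr rfl fun n hn => ?_
    simp only [Finset.mem_Icc] at hn
    rw [qt_eq (by omega) y (hy n (by omega)), PiK]
    push_cast; ring
  · intro i _ j _ h
    exact tt_inj (by rw [Complex.ofReal_injective h])
  · intro j hj; simp only [Finset.mem_Icc] at hj; exact hy j (by omega)

lemma PF_neg_tt (k : ℕ) (hk : k ≠ 0) : PF (-tt k) = 0 := by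
  have h := PF_tendsto (-tt k) ?_
  · refine tendsto_nhds_unique h ?_
    refine tendsto_const_nhds.congr' ?_
    filter_upwards [Filter.eventually_ge_atTop k] with K hK
    rw [Finset.prod_eq_zero (i := k)]
    · simp; omega
    · simp
  · intro n hn h2
    have h3 : tt n + tt k = 0 := by
      have : ((tt n + tt k : ℝ) : ℂ) = 0 := by push_cast; rw [h2]; ring
      exact_mod_cast this
    exact tt_add_ne hk h3

lemma mu_add_ne {n k : ℕ} (hk : k ≠ 0) (hn : n ≠ 0) : mu n + mu k ≠ 0 := by
  have h1 := tt_ne hk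
  have h2 := tt_ne hn
  have h3 := tt_add_ne (i := n) hk
  rw [mu_eq, mu_eq]
  intro h
  apply h3
  field_simp at h
  linarith

/-- (Q1) -/
lemma kap_Q1 (k : ℕ) (hk : k ≠ 0) : 2 * ∑' n, kap n * (mu n / (mu n + mu k)) = 1 := by
  have h := PF_neg_tt k hk
  rw [PF] at h
  have h2 : ∀ n, (kap n : ℂ) * qt (-tt k) n = ((-(2 * (kap n * (mu n / (mu n + mu k)))) : ℝ) : ℂ) := by
    intro n
    rcases Nat.eq_zero_or_pos n with rfl | hn
    · simp [qt_zero, mu_zero]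
    · have h3 := mu_add_ne hk (n := n) (by omega)
      have h4 : mu k * tt k = 1 := by rw [mu_eq]; field_simp [tt_ne hk]
      have h6 : (mu k : ℂ) * tt k = 1 := by exact_mod_cast h4
      have h7 : (mu n : ℂ) + mu k ≠ 0 := by exact_mod_cast h3
      have h8 : 1 - -(tt k : ℂ) * mu n ≠ 0 := by
        intro h9; apply h7; linear_combination (mu k : ℂ) * h9 - mu n * h6
      rw [qt]; push_cast
      have : -(tt k : ℂ) * mu n / (1 - -(tt k : ℂ) * mu n) = -(mu n / (mu n + mu k)) := by
        rw [← neg_div, div_eq_div_iff h8 h7]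
        linear_combination - (mu n : ℂ) * h6
      rw [this]; ring
  simp only [h2] at h
  rw [← Complex.ofReal_tsum, tsum_neg, tsum_mul_left] at h
  have h5 : (1 : ℝ) + -(2 * ∑' n, kap n * (mu n / (mu n + mu k))) = 0 := by exact_mod_cast h
  linarith

/-- partial Euler product -/
noncomputable def EE (z : ℂ) (K : ℕ) : ℂ := ∏ j ∈ Finset.range K, (1 - z ^ 2 / ((j : ℂ) + 1) ^ 2)

lemma prod_EE (s : ℂ) (hy : ∀ n : ℕ, n ≠ 0 → (tt n : ℂ) ≠ s ^ 2) (K : ℕ) :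
    (∏ j ∈ Finset.Icc 1 (2 * K), ((tt j : ℂ) + s ^ 2) / (tt j - s ^ 2)) * EE (s / 2) K ^ 2 * EE (Complex.I * s) (2 * K)
      = EE (Complex.I * s / 2) K ^ 2 * EE s (2 * K) := by
  induction K with
  | zero => simp [EE]
  | succ K ih =>
    have e1 : ∀ z, EE z (K + 1) = EE z K * (1 - z ^ 2 / ((K : ℂ) + 1) ^ 2) := fun z => Finset.prod_range_succ _ _
    have e2 : ∀ z, EE z (2 * (K + 1)) = EE z (2 * K) * (1 - z ^ 2 / (2 * (K : ℂ) + 1) ^ 2) * (1 - z ^ 2 / (2 * (K : ℂ) + 2) ^ 2) := by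
      intro z
      rw [show 2 * (K + 1) = 2 * K + 1 + 1 by ring, EE, Finset.prod_range_succ, Finset.prod_range_succ, EE]
      push_cast
      rw [show 2 * (K : ℂ) + 1 + 1 = 2 * K + 2 by ring]
    have e3 : ∏ j ∈ Finset.Icc 1 (2 * (K + 1)), ((tt j : ℂ) + s ^ 2) / (tt j - s ^ 2) =
      (∏ j ∈ Finset.Icc 1 (2 * K), ((tt j : ℂ) + s ^ 2) / (tt j - s ^ 2)) *
        ((-(2 * K + 1) ^ 2 + s ^ 2) / (-(2 * K + 1) ^ 2 - s ^ 2)) * (((2 * K + 2) ^ 2 + s ^ 2) / ((2 * K + 2) ^ 2 - s ^ 2)) := by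
      rw [show 2 * (K + 1) = 2 * K + 1 + 1 by ring, Finset.prod_Icc_succ_top (by omega), Finset.prod_Icc_succ_top (by omega)]
      have a1 : (tt (2 * K + 1) : ℂ) = -(2 * K + 1) ^ 2 := by
        rw [tt, Odd.neg_one_pow (by exact ⟨K, rfl⟩)]; push_cast; ring
      have a2 : (tt (2 * K + 1 + 1) : ℂ) = (2 * K + 2) ^ 2 := by
        rw [tt, Even.neg_one_pow (by exact ⟨K + 1, by ring⟩)]; push_cast; ring
      rw [a1, a2]
    have n1 : -(2 * (K : ℂ) + 1) ^ 2 - s ^ 2 ≠ 0 := by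
      have := hy (2 * K + 1) (by omega)
      rw [tt, Odd.neg_one_pow (by exact ⟨K, rfl⟩)] at this; push_cast at this
      intro h; apply this; linear_combination h
    have n2 : (2 * (K : ℂ) + 2) ^ 2 - s ^ 2 ≠ 0 := by
      have := hy (2 * K + 2) (by omega)
      rw [tt, Even.neg_one_pow (by exact ⟨K + 1, by ring⟩)] at this; push_cast at this
      intro h; apply this; linear_combination h
    have n3 : 2 * (K : ℂ) + 1 ≠ 0 := by exact_mod_cast (by omega : 2 * K + 1 ≠ 0)
    have n4 : (K : ℂ) + 1 ≠ 0 := by exact_mod_cast (by omega : K + 1 ≠ 0)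
    have n5 : 2 * (K : ℂ) + 2 ≠ 0 := by exact_mod_cast (by omega : 2 * K + 2 ≠ 0)
    have hI : Complex.I ^ 2 = -1 := Complex.I_sq
    have key : ((-(2 * K + 1) ^ 2 + s ^ 2) / (-(2 * K + 1) ^ 2 - s ^ 2)) * (((2 * K + 2) ^ 2 + s ^ 2) / ((2 * K + 2) ^ 2 - s ^ 2))
      * (1 - (s / 2) ^ 2 / ((K : ℂ) + 1) ^ 2) ^ 2 * ((1 - (Complex.I * s) ^ 2 / (2 * (K : ℂ) + 1) ^ 2) * (1 - (Complex.I * s) ^ 2 / (2 * (K : ℂ) + 2) ^ 2))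
      = (1 - (Complex.I * s / 2) ^ 2 / ((K : ℂ) + 1) ^ 2) ^ 2 * ((1 - s ^ 2 / (2 * (K : ℂ) + 1) ^ 2) * (1 - s ^ 2 / (2 * (K : ℂ) + 2) ^ 2)) := by
      have r1 : 1 - (s / 2) ^ 2 / ((K : ℂ) + 1) ^ 2 = ((2 * (K : ℂ) + 2) ^ 2 - s ^ 2) / (2 * (K : ℂ) + 2) ^ 2 := by
        rw [show 2 * (K : ℂ) + 2 = 2 * (K + 1) by ring]; field_simp
      have r2 : 1 - (Complex.I * s / 2) ^ 2 / ((K : ℂ) + 1) ^ 2 = ((2 * (K : ℂ) + 2) ^ 2 + s ^ 2) / (2 * (K : ℂ) + 2) ^ 2 := by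
        rw [div_pow, mul_pow, hI, show 2 * (K : ℂ) + 2 = 2 * (K + 1) by ring]; field_simp; ring
      have r3 : ∀ a : ℂ, a ≠ 0 → 1 - s ^ 2 / a ^ 2 = (a ^ 2 - s ^ 2) / a ^ 2 := fun a ha => by field_simp
      have r4 : ∀ a : ℂ, a ≠ 0 → 1 - (Complex.I * s) ^ 2 / a ^ 2 = (a ^ 2 + s ^ 2) / a ^ 2 := fun a ha => by
        rw [mul_pow, hI]; field_simp; ring
      rw [r1, r2, r3 _ n3, r3 _ n5, r4 _ n3, r4 _ n5]
      generalize (2 * (K : ℂ) + 2) = b at *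
      generalize (2 * (K : ℂ) + 1) = a at *
      field_simp
      ring
    rw [e1, e1, e2, e2, e3]
    linear_combination (((-(2 * K + 1) ^ 2 + s ^ 2) / (-(2 * K + 1) ^ 2 - s ^ 2)) * (((2 * K + 2) ^ 2 + s ^ 2) / ((2 * K + 2) ^ 2 - s ^ 2))
      * (1 - (s / 2) ^ 2 / ((K : ℂ) + 1) ^ 2) ^ 2 * ((1 - (Complex.I * s) ^ 2 / (2 * (K : ℂ) + 1) ^ 2) * (1 - (Complex.I * s) ^ 2 / (2 * (K : ℂ) + 2) ^ 2))) * ih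
      + (EE (Complex.I * s / 2) K ^ 2 * EE s (2 * K)) * key

lemma PF_sin (s : ℂ) (hy : ∀ n : ℕ, n ≠ 0 → (tt n : ℂ) ≠ s ^ 2) :
    PF (s ^ 2) * Complex.sin (Real.pi * (s / 2)) ^ 2 * Complex.sin (Real.pi * (Complex.I * s)) =
    -Complex.I * (Complex.sin (Real.pi * (Complex.I * s / 2)) ^ 2 * Complex.sin (Real.pi * s)) := by
  have hE : ∀ z, Filter.Tendsto (fun K => Real.pi * z * EE z K) Filter.atTop (nhds (Complex.sin (Real.pi * z))) :=
    fun z => Complex.tendsto_euler_sin_prod z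
  have h2 : Filter.Tendsto (fun K : ℕ => 2 * K) Filter.atTop Filter.atTop :=
    Filter.tendsto_id.const_mul_atTop' (by norm_num)
  have hL := (((PF_tendsto (s ^ 2) hy).comp h2).mul ((hE (s / 2)).pow 2)).mul ((hE (Complex.I * s)).comp h2)
  have hR := (((hE (Complex.I * s / 2)).pow 2).mul ((hE s).comp h2)).const_mul (-Complex.I)
  refine tendsto_nhds_unique hL (hR.congr fun K => ?_)
  have := prod_EE s hy K
  simp only [Function.comp]
  have hI : Complex.I ^ 2 = -1 := Complex.I_sq
  linear_combination (-(Complex.I * (Real.pi * s) ^ 3 / 4)) * this - (Real.pi * s) ^ 3 / 4 * Complex.I * EE (Complex.I * s / 2) K ^ 2 * EE s (2 * K) * hI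

lemma kap_qt_summable (y : ℂ) : Summable (fun n => (kap n : ℂ) * qt y n) := by
  refine Summable.of_norm_bounded (qt_summable y) fun n => ?_
  rcases Nat.eq_zero_or_pos n with rfl | hn
  · simp [qt_zero]
  · rw [norm_mul, Complex.norm_real, Real.norm_eq_abs]
    exact mul_le_of_le_one_left (norm_nonneg _) (kap_bound n (by omega))

lemma sin_pi_ne (z : ℂ) (h : z.im ≠ 0) : Complex.sin (Real.pi * z) ≠ 0 := by
  rw [Ne, Complex.sin_eq_zero_iff]
  rintro ⟨k, hk⟩
  have hpi : (Real.pi : ℂ) ≠ 0 := by exact_mod_cast Real.pi_ne_zero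
  have : z = k := by
    apply mul_left_cancel₀ hpi; rw [hk]; ring
  apply h; rw [this]; simp

lemma PF_at (k : ℕ) (hk : k ≠ 0) : PF (2 * Complex.I * k ^ 2) = -Complex.I ∧ PF (-(2 * Complex.I * k ^ 2)) = Complex.I := by
  have hI : Complex.I ^ 2 = -1 := Complex.I_sq
  have hkr : (k : ℝ) ≠ 0 := by exact_mod_cast hk
  have him : ∀ n : ℕ, ∀ y : ℂ, y.im ≠ 0 → (tt n : ℂ) ≠ y := by
    intro n y hy h; apply hy; rw [← h]; simp
  constructor
  · have hs : (2 * Complex.I * k ^ 2 : ℂ) = ((1 + Complex.I) * k) ^ 2 := by linear_combination (-(k : ℂ) ^ 2) * hI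
    have h := PF_sin ((1 + Complex.I) * k) (fun n _ => by
      apply him; rw [← hs]
      simp [← Complex.ofReal_natCast, ← Complex.ofReal_pow, hk])
    rw [← hs] at h
    have e1 : Complex.sin (Real.pi * (Complex.I * ((1 + Complex.I) * k))) = Complex.sin (Real.pi * ((1 + Complex.I) * k)) := by
      rw [← Complex.sin_sub_nat_mul_two_pi (Real.pi * ((1 + Complex.I) * k)) k]; congr 1
      linear_combination (Real.pi * k : ℂ) * hI
    have e2 : Complex.sin (Real.pi * (Complex.I * ((1 + Complex.I) * k) / 2)) ^ 2 = Complex.sin (Real.pi * ((1 + Complex.I) * k / 2)) ^ 2 := by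
      have : (Real.pi * (Complex.I * ((1 + Complex.I) * k) / 2) : ℂ) = Real.pi * ((1 + Complex.I) * k / 2) - k * Real.pi := by
        linear_combination (Real.pi * k / 2 : ℂ) * hI
      rw [this, Complex.sin_antiperiodic.sub_nat_mul_eq, mul_pow, ← pow_mul, mul_comm k 2, pow_mul]; simp
    rw [e1, e2] at h
    have n1 : Complex.sin (Real.pi * ((1 + Complex.I) * k)) ≠ 0 := sin_pi_ne _ (by simp [hk])
    have n2 : Complex.sin (Real.pi * ((1 + Complex.I) * k / 2)) ≠ 0 := sin_pi_ne _ (by simp [hk])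
    apply mul_right_cancel₀ (mul_ne_zero (pow_ne_zero 2 n2) n1)
    linear_combination h
  · have hs : (-(2 * Complex.I * k ^ 2) : ℂ) = ((1 - Complex.I) * k) ^ 2 := by linear_combination (-(k : ℂ) ^ 2) * hI
    have h := PF_sin ((1 - Complex.I) * k) (fun n _ => by
      apply him; rw [← hs]
      simp [← Complex.ofReal_natCast, ← Complex.ofReal_pow, hk])
    rw [← hs] at h
    have e1 : Complex.sin (Real.pi * (Complex.I * ((1 - Complex.I) * k))) = -Complex.sin (Real.pi * ((1 - Complex.I) * k)) := by
      rw [← Complex.sin_neg, ← Complex.sin_sub_nat_mul_two_pi _ k]; congr 1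
      linear_combination -(Real.pi * k : ℂ) * hI
    have e2 : Complex.sin (Real.pi * (Complex.I * ((1 - Complex.I) * k) / 2)) ^ 2 = Complex.sin (Real.pi * ((1 - Complex.I) * k / 2)) ^ 2 := by
      have : (Real.pi * (Complex.I * ((1 - Complex.I) * k) / 2) : ℂ) = -(Real.pi * ((1 - Complex.I) * k / 2) - k * Real.pi) := by
        linear_combination (-Real.pi * k / 2 : ℂ) * hI
      rw [this, Complex.sin_neg, Complex.sin_antiperiodic.sub_nat_mul_eq, neg_sq, mul_pow, ← pow_mul, mul_comm k 2, pow_mul]; simp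
    rw [e1, e2] at h
    have n1 : Complex.sin (Real.pi * ((1 - Complex.I) * k)) ≠ 0 := sin_pi_ne _ (by simp [hk])
    have n2 : Complex.sin (Real.pi * ((1 - Complex.I) * k / 2)) ≠ 0 := sin_pi_ne _ (by simp [hk])
    apply mul_right_cancel₀ (mul_ne_zero (pow_ne_zero 2 n2) n1)
    linear_combination -h

/-- (Q2) -/
lemma kap_Q2 (k : ℕ) (hk : k ≠ 0) : 2 * ∑' n, kap n * (mu n ^ 2 / (mu n ^ 2 + 1 / (4 * (k : ℝ) ^ 4))) = 1 := by
  obtain ⟨h1, h2⟩ := PF_at k hk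
  have h : PF (2 * Complex.I * k ^ 2) + PF (-(2 * Complex.I * k ^ 2)) = 0 := by rw [h1, h2]; ring
  rw [PF, PF] at h
  have h3 := (kap_qt_summable (2 * Complex.I * k ^ 2)).tsum_add (kap_qt_summable (-(2 * Complex.I * k ^ 2)))
  have h4 : ∀ n, (kap n : ℂ) * qt (2 * Complex.I * k ^ 2) n + (kap n : ℂ) * qt (-(2 * Complex.I * k ^ 2)) n =
      ((-4 * (kap n * (mu n ^ 2 / (mu n ^ 2 + 1 / (4 * (k : ℝ) ^ 4)))) : ℝ) : ℂ) := by
    intro n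
    have hk0 : (k : ℂ) ≠ 0 := by exact_mod_cast hk
    have hI : Complex.I ^ 2 = -1 := Complex.I_sq
    have hp : (4 * (k : ℂ) ^ 4 * (mu n : ℂ) ^ 2 + 1) ≠ 0 := by
      have : 4 * (k : ℝ) ^ 4 * (mu n) ^ 2 + 1 ≠ 0 := by positivity
      exact_mod_cast this
    have hm : (1 - 2 * Complex.I * k ^ 2 * mu n) * (1 - -(2 * Complex.I * k ^ 2) * mu n) = 4 * (k : ℂ) ^ 4 * (mu n : ℂ) ^ 2 + 1 := by
      linear_combination (-4 * (k : ℂ) ^ 4 * mu n ^ 2) * hI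
    rw [← hm] at hp
    have ha := left_ne_zero_of_mul hp
    have hb := right_ne_zero_of_mul hp
    have e : (mu n : ℂ) ^ 2 / (mu n ^ 2 + 1 / (4 * (k : ℂ) ^ 4)) = 4 * (k : ℂ) ^ 4 * (mu n : ℂ) ^ 2 / (4 * (k : ℂ) ^ 4 * (mu n : ℂ) ^ 2 + 1) := by
      field_simp
    push_cast
    rw [e, qt, qt, ← hm, show (4 * (k : ℂ) ^ 4 * (mu n : ℂ) ^ 2) = -(2 * Complex.I * k ^ 2 * mu n) ^ 2 by
      linear_combination (4 * (k : ℂ) ^ 4 * mu n ^ 2) * hI]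
    rw [neg_mul, sub_neg_eq_add] at hb ⊢
    generalize 2 * Complex.I * (k : ℂ) ^ 2 * mu n = u at ha hb ⊢
    field_simp
    ring
  simp only [h4] at h3
  rw [← Complex.ofReal_tsum, tsum_mul_left] at h3
  have h5 : ((2 + -4 * ∑' n, (kap n * (mu n ^ 2 / (mu n ^ 2 + 1 / (4 * (k : ℝ) ^ 4)))) : ℝ) : ℂ) = 0 := by
    push_cast at h3 ⊢
    rw [h3]; linear_combination h
  have h6 : 2 + -4 * ∑' n, (kap n * (mu n ^ 2 / (mu n ^ 2 + 1 / (4 * (k : ℝ) ^ 4)))) = 0 := by exact_mod_cast h5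
  linarith

/-- twice the weighted power sums -/
noncomputable def Pd (d : ℕ) : ℝ := if d = 0 then 1 else 2 * ∑' n, kap n * mu n ^ d

lemma kap_mu_norm (n d : ℕ) : ‖(kap n : ℂ) * (mu n : ℂ) ^ (d + 1)‖ ≤ 1 / (n : ℝ) ^ 2 := by
  rcases Nat.eq_zero_or_pos n with rfl | hn
  · simp [mu_zero]
  · rw [norm_mul, norm_pow, norm_mu, Complex.norm_real, Real.norm_eq_abs]
    have h1 := kap_bound n (by omega)
    have h2 : (1 / (n : ℝ) ^ 2) ^ (d + 1) ≤ 1 / (n : ℝ) ^ 2 := by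
      have h3 := abs_mu_le n
      rw [abs_mu] at h3
      rw [pow_succ]
      exact mul_le_of_le_one_left (by positivity) (pow_le_one₀ (by positivity) h3)
    have h4 : 0 ≤ (1 / (n : ℝ) ^ 2) ^ (d + 1) := by positivity
    nlinarith [abs_nonneg (kap n)]

lemma sum_inv_sq : Summable (fun n : ℕ => 1 / (n : ℝ) ^ 2) := Real.summable_one_div_nat_pow.mpr (by norm_num)

lemma PF_series (y : ℂ) (hy : ‖y‖ < 1) : Summable (fun d => ‖(Pd d : ℂ) * y ^ d‖) ∧ ∑' d, (Pd d : ℂ) * y ^ d = PF y := by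
  have hg : Summable (fun d : ℕ => ‖y‖ ^ (d + 1)) := (summable_nat_add_iff 1).mpr (summable_geometric_of_lt_one (norm_nonneg _) hy)
  have hsum : Summable (fun p : ℕ × ℕ => 2 * ((1 / (p.1 : ℝ) ^ 2) * ‖y‖ ^ (p.2 + 1))) :=
    (sum_inv_sq.mul_of_nonneg hg (fun _ => by positivity) (fun _ => by positivity)).mul_left 2
  have hF : Summable (fun p : ℕ × ℕ => 2 * ((kap p.1 : ℂ) * (mu p.1 : ℂ) ^ (p.2 + 1)) * y ^ (p.2 + 1)) := by
    refine Summable.of_norm_bounded hsum fun p => ?_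
    rw [norm_mul, norm_mul, norm_pow, Complex.norm_ofNat, mul_assoc]
    have := kap_mu_norm p.1 p.2
    gcongr
  have e1 : ∀ n, ∑' d, 2 * ((kap n : ℂ) * (mu n : ℂ) ^ (d + 1)) * y ^ (d + 1) = kap n * qt y n := by
    intro n
    have hn : ‖y * mu n‖ < 1 := by
      rw [norm_mul, norm_mu, ← abs_mu]
      exact lt_of_le_of_lt (mul_le_of_le_one_right (norm_nonneg _) (abs_mu_le n)) hy
    have : ∀ d, 2 * ((kap n : ℂ) * (mu n : ℂ) ^ (d + 1)) * y ^ (d + 1) = (2 * kap n * (y * mu n)) * (y * mu n) ^ d := by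
      intro d; ring
    simp only [this]
    rw [tsum_mul_left, tsum_geometric_of_norm_lt_one hn, qt]; ring
  have e2 : ∀ d, ∑' n, 2 * ((kap n : ℂ) * (mu n : ℂ) ^ (d + 1)) * y ^ (d + 1) = Pd (d + 1) * y ^ (d + 1) := by
    intro d
    rw [tsum_mul_right, tsum_mul_left, Pd, if_neg (by omega)]
    push_cast; rfl
  have hP0 : Pd 0 = 1 := by simp [Pd]
  have hs : Summable (fun d => ‖(Pd d : ℂ) * y ^ d‖) := by
    rw [← summable_nat_add_iff 1]
    have h1 : Summable (fun d : ℕ => (2 * ∑' n : ℕ, 1 / (n : ℝ) ^ 2) * ‖y‖ ^ (d + 1)) := hg.mul_left _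
    refine Summable.of_nonneg_of_le (fun _ => norm_nonneg _) (fun d => ?_) h1
    rw [norm_mul, norm_pow]
    gcongr
    rw [Pd, if_neg (by omega)]; push_cast
    rw [norm_mul, Complex.norm_ofNat]
    gcongr
    exact tsum_of_norm_bounded sum_inv_sq.hasSum (fun n => kap_mu_norm n d)
  refine ⟨hs, ?_⟩
  rw [hs.of_norm.tsum_eq_zero_add, hP0, PF]
  have e3 := Summable.tsum_comm (f := fun n d : ℕ => 2 * ((kap n : ℂ) * (mu n : ℂ) ^ (d + 1)) * y ^ (d + 1)) hF
  rw [tsum_congr e1, tsum_congr e2] at e3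
  rw [← e3, pow_zero, mul_one, Complex.ofReal_one]

lemma series_unique (a : ℕ → ℂ) (r : ℝ) (hr : 0 < r) (hs : Summable (fun d => ‖a d‖ * r ^ d))
    (h : ∀ y : ℝ, 0 < y → y < r → ∑' d, a d * (y : ℂ) ^ d = 0) (N : ℕ) : a N = 0 := by
  induction N using Nat.strong_induction_on with
  | _ N ih =>
    set T : ℝ := ∑' d, ‖a (d + (N + 1))‖ * r ^ d with hT
    have hs2 : Summable (fun d => ‖a (d + (N + 1))‖ * r ^ d) := by
      have h1 := ((summable_nat_add_iff (N + 1)).mpr hs).mul_right ((r ^ (N + 1))⁻¹)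
      refine h1.congr fun d => ?_
      rw [pow_add]; field_simp
    have hT0 : 0 ≤ T := tsum_nonneg fun d => by positivity
    have key : ∀ y : ℝ, 0 < y → y < r → ‖a N‖ ≤ y * T := by
      intro y hy hyr
      have hsy : Summable (fun d => a d * (y : ℂ) ^ d) := by
        refine Summable.of_norm_bounded hs fun d => ?_
        rw [norm_mul, norm_pow, Complex.norm_real, Real.norm_of_nonneg hy.le]
        gcongr
      have h1 := h y hy hyr
      rw [← hsy.sum_add_tsum_nat_add (N + 1), Finset.sum_range_succ, Finset.sum_eq_zero, zero_add] at h1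
      · have h2 : ∀ d, a (d + (N + 1)) * (y : ℂ) ^ (d + (N + 1)) = (y ^ (N + 1) : ℂ) * (a (d + (N + 1)) * y ^ d) := by
          intro d; ring
        simp only [h2] at h1
        rw [tsum_mul_left] at h1
        have hy0 : (y : ℂ) ^ N ≠ 0 := pow_ne_zero _ (by exact_mod_cast hy.ne')
        have h3 : a N = -(y * ∑' d, a (d + (N + 1)) * (y : ℂ) ^ d) := by
          apply mul_left_cancel₀ hy0; linear_combination h1
        rw [h3, norm_neg, norm_mul, Complex.norm_real, Real.norm_of_nonneg hy.le]
        gcongr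
        refine tsum_of_norm_bounded hs2.hasSum fun d => ?_
        rw [norm_mul, norm_pow, Complex.norm_real, Real.norm_of_nonneg hy.le]
        gcongr
      · intro d hd
        rw [ih d (Finset.mem_range.mp hd), zero_mul]
    by_contra hne
    have hpos : 0 < ‖a N‖ := norm_pos_iff.mpr hne
    have h4 := key (min (r / 2) (‖a N‖ / (2 * (T + 1)))) (by positivity) (lt_of_le_of_lt (min_le_left _ _) (by linarith))
    have h5 : min (r / 2) (‖a N‖ / (2 * (T + 1))) * T ≤ ‖a N‖ / (2 * (T + 1)) * T := by gcongr; exact min_le_right _ _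
    have h6 : ‖a N‖ / (2 * (T + 1)) * T ≤ ‖a N‖ / 2 := by
      rw [div_mul_eq_mul_div, div_le_div_iff₀ (by positivity) (by positivity)]
      nlinarith
    linarith

lemma zeta_even_succ (a : ℕ) : riemannZeta (2 * ((a + 1 : ℕ) : ℂ)) = ∑' n : ℕ, 1 / ((n : ℂ) + 1) ^ (2 * a + 2) := by
  have h := zeta_nat_eq_tsum_of_gt_one (k := 2 * a + 2) (by omega)
  rw [show (2 * ((a + 1 : ℕ) : ℂ)) = ((2 * a + 2 : ℕ) : ℂ) by push_cast; ring, h]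
  have hs : Summable (fun n : ℕ => 1 / (n : ℂ) ^ (2 * a + 2)) := by
    have : Summable (fun n : ℕ => 1 / (n : ℝ) ^ (2 * a + 2)) := Real.summable_one_div_nat_pow.mpr (by omega)
    refine Summable.of_norm ?_
    simp
  rw [hs.tsum_eq_zero_add]; simp

lemma sum_inv_sq' : Summable (fun n : ℕ => 1 / ((n : ℝ) + 1) ^ 2) := by
  have := (summable_nat_add_iff 1).mpr sum_inv_sq
  simpa using this

lemma inv_pow_norm (n a : ℕ) : ‖(1 : ℂ) / ((n : ℂ) + 1) ^ (2 * a + 2)‖ ≤ 1 / ((n : ℝ) + 1) ^ 2 := by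
  have : ‖((n : ℂ) + 1)‖ = (n : ℝ) + 1 := by
    rw [show ((n : ℂ) + 1) = ((n + 1 : ℕ) : ℂ) by push_cast; rfl, Complex.norm_natCast]; push_cast; rfl
  rw [norm_div, norm_pow, this, norm_one]
  have h1 : (1 : ℝ) ≤ n + 1 := by have : (0 : ℝ) ≤ n := Nat.cast_nonneg n
                                  linarith
  gcongr 1 / ?_
  exact pow_le_pow_right₀ h1 (by omega)

lemma mem_compl_of_norm (t : ℂ) (ht : t ≠ 0) (h : ‖t‖ < 1) : t ∈ Complex.integerComplement := by
  rw [Complex.mem_integerComplement_iff]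
  rintro ⟨k, hk⟩
  rw [← hk, Complex.norm_intCast] at h
  have h2 : k = 0 := by
    have : |k| < 1 := by exact_mod_cast h
    exact Int.abs_lt_one_iff.mp this
  apply ht; rw [← hk, h2]; simp

lemma zeta_series (t : ℂ) (ht : t ≠ 0) (h : ‖t‖ < 1) :
    Summable (fun a : ℕ => ‖riemannZeta (2 * (a : ℂ)) * t ^ (2 * a)‖) ∧
    ∑' a : ℕ, riemannZeta (2 * (a : ℂ)) * t ^ (2 * a) = -(Real.pi * t / 2) * Complex.cot (Real.pi * t) := by
  have ht2 : ‖t‖ ^ 2 < 1 := by nlinarith [norm_nonneg t]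
  have hg : Summable (fun a : ℕ => (‖t‖ ^ 2) ^ (a + 1)) :=
    (summable_nat_add_iff 1).mpr (summable_geometric_of_lt_one (by positivity) ht2)
  have hsum : Summable (fun p : ℕ × ℕ => ((1 / ((p.1 : ℝ) + 1) ^ 2) * (‖t‖ ^ 2) ^ (p.2 + 1))) :=
    (sum_inv_sq'.mul_of_nonneg hg (fun _ => by positivity) (fun _ => by positivity))
  have hF : Summable (fun p : ℕ × ℕ => 1 / ((p.1 : ℂ) + 1) ^ (2 * p.2 + 2) * t ^ (2 * (p.2 + 1))) := by
    refine Summable.of_norm_bounded hsum fun p => ?_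
    rw [norm_mul, norm_pow, pow_mul]
    have := inv_pow_norm p.1 p.2
    gcongr
  have hs : Summable (fun a : ℕ => ‖riemannZeta (2 * (a : ℂ)) * t ^ (2 * a)‖) := by
    rw [← summable_nat_add_iff 1]
    have h1 : Summable (fun a : ℕ => (∑' n : ℕ, 1 / ((n : ℝ) + 1) ^ 2) * (‖t‖ ^ 2) ^ (a + 1)) := hg.mul_left _
    refine Summable.of_nonneg_of_le (fun _ => norm_nonneg _) (fun a => ?_) h1
    rw [norm_mul, norm_pow, pow_mul, zeta_even_succ]
    gcongr
    exact tsum_of_norm_bounded sum_inv_sq'.hasSum (fun n => inv_pow_norm n a)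
  refine ⟨hs, ?_⟩
  have hz := mem_compl_of_norm t ht h
  rw [hs.of_norm.tsum_eq_zero_add]
  have e3 := Summable.tsum_comm (f := fun n a : ℕ => 1 / ((n : ℂ) + 1) ^ (2 * a + 2) * t ^ (2 * (a + 1))) hF
  have e2 : ∀ a : ℕ, ∑' n : ℕ, 1 / ((n : ℂ) + 1) ^ (2 * a + 2) * t ^ (2 * (a + 1)) = riemannZeta (2 * ((a + 1 : ℕ) : ℂ)) * t ^ (2 * (a + 1)) := by
    intro a; rw [tsum_mul_right, zeta_even_succ]
  have e1 : ∀ n : ℕ, ∑' a : ℕ, 1 / ((n : ℂ) + 1) ^ (2 * a + 2) * t ^ (2 * (a + 1)) = (-(t / 2)) * (1 / (t - (n + 1)) + 1 / (t + (n + 1))) := by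
    intro n
    have hn0 : ((n : ℂ) + 1) ≠ 0 := by exact_mod_cast Nat.succ_ne_zero n
    have hn : ‖(t / (n + 1)) ^ 2‖ < 1 := by
      have : ‖((n : ℂ) + 1)‖ = (n : ℝ) + 1 := by
        rw [show ((n : ℂ) + 1) = ((n + 1 : ℕ) : ℂ) by push_cast; rfl, Complex.norm_natCast]; push_cast; rfl
      rw [norm_pow, norm_div, this]
      have h1 : ‖t‖ / ((n : ℝ) + 1) ≤ ‖t‖ := div_le_self (norm_nonneg _) (by have : (0 : ℝ) ≤ n := Nat.cast_nonneg n
                                                                             linarith)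
      have h2 : 0 ≤ ‖t‖ / ((n : ℝ) + 1) := by positivity
      nlinarith
    have : ∀ a : ℕ, 1 / ((n : ℂ) + 1) ^ (2 * a + 2) * t ^ (2 * (a + 1)) = (t / (n + 1)) ^ 2 * ((t / (n + 1)) ^ 2) ^ a := by
      intro a
      rw [← pow_succ', ← pow_mul, div_pow, show 2 * a + 2 = 2 * (a + 1) by ring]; ring
    rw [tsum_congr this, tsum_mul_left, tsum_geometric_of_norm_lt_one hn]
    have m1 : t - (n + 1) ≠ 0 := by
      have := Complex.integerComplement_add_ne_zero hz (-(n + 1 : ℤ))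
      push_cast at this; intro h; apply this; linear_combination h
    have m2 : t + (n + 1) ≠ 0 := by
      have := Complex.integerComplement_add_ne_zero hz ((n + 1 : ℤ))
      push_cast at this; intro h; apply this; linear_combination h
    have m3 : ((n : ℂ) + 1) ^ 2 - t ^ 2 ≠ 0 := by
      intro h; apply mul_ne_zero m1 m2; linear_combination -h
    have m4 : (1 - (t / (n + 1)) ^ 2) = (((n : ℂ) + 1) ^ 2 - t ^ 2) / ((n : ℂ) + 1) ^ 2 := by field_simp
    rw [m4, div_add_div _ _ m1 m2, show (t - ((n : ℂ) + 1)) * (t + (n + 1)) = -(((n : ℂ) + 1) ^ 2 - t ^ 2) by ring]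
    field_simp
    ring
  rw [tsum_congr e1, tsum_congr e2, tsum_mul_left, ← cot_series_rep' hz] at e3
  rw [e3]
  simp only [Nat.cast_zero, mul_zero, pow_zero, mul_one, riemannZeta_zero]
  field_simp
  ring

noncomputable def aco (a : ℕ) : ℂ := (1 / 4) ^ a * (-1) ^ a * (1 - 4 ^ a) * riemannZeta (2 * (a : ℂ))
noncomputable def bco (b : ℕ) : ℂ := (1 / 4) ^ b * riemannZeta (2 * (b : ℂ))
noncomputable def pco (d : ℕ) : ℂ := ∑ x ∈ Finset.HasAntidiagonal.antidiagonal d, aco x.1 * bco x.2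

lemma pco_series (s : ℝ) (hs0 : 0 < s) (hs1 : s < 1) :
    Summable (fun d => ‖pco d * ((s : ℂ) ^ 2) ^ d‖) ∧
    ∑' d, pco d * ((s : ℂ) ^ 2) ^ d = -(Real.pi ^ 2 / 16) * (s : ℂ) ^ 2 * PF ((s : ℂ) ^ 2) := by
  have hI : Complex.I ^ 2 = -1 := Complex.I_sq
  have hsc : (s : ℂ) ≠ 0 := by exact_mod_cast hs0.ne'
  have hns : ‖(s : ℂ)‖ = s := by rw [Complex.norm_real, Real.norm_of_nonneg hs0.le]
  have hz1 : Complex.I * s / 2 ≠ 0 := by simp [hsc]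
  have hz2 : Complex.I * s ≠ 0 := by simp [hsc]
  have hz3 : (s : ℂ) / 2 ≠ 0 := by simp [hsc]
  have hn1 : ‖Complex.I * s / 2‖ < 1 := by simp [abs_of_pos hs0]; linarith
  have hn2 : ‖Complex.I * s‖ < 1 := by simp [abs_of_pos hs0]; linarith
  have hn3 : ‖(s : ℂ) / 2‖ < 1 := by simp [abs_of_pos hs0]; linarith
  obtain ⟨s1, c1⟩ := zeta_series _ hz1 hn1
  obtain ⟨s2, c2⟩ := zeta_series _ hz2 hn2
  obtain ⟨s3, c3⟩ := zeta_series _ hz3 hn3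
  have eA : ∀ a : ℕ, aco a * ((s : ℂ) ^ 2) ^ a = riemannZeta (2 * (a : ℂ)) * (Complex.I * s / 2) ^ (2 * a) - riemannZeta (2 * (a : ℂ)) * (Complex.I * s) ^ (2 * a) := by
    intro a
    rw [aco, pow_mul, pow_mul, div_pow (Complex.I * s), mul_pow Complex.I, hI]
    have h4 : ((1 : ℂ) / 4) ^ a * 4 ^ a = 1 := by rw [← mul_pow]; norm_num
    rw [show (-1 * (s : ℂ) ^ 2 / 2 ^ 2) ^ a = (1 / 4) ^ a * (-1) ^ a * ((s : ℂ) ^ 2) ^ a by rw [← mul_pow, ← mul_pow]; congr 1; ring,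
      mul_pow (-1 : ℂ)]
    linear_combination (-(-1) ^ a * riemannZeta (2 * (a : ℂ)) * ((s : ℂ) ^ 2) ^ a) * h4
  have eB : ∀ a : ℕ, bco a * ((s : ℂ) ^ 2) ^ a = riemannZeta (2 * (a : ℂ)) * (s / 2) ^ (2 * a) := by
    intro a
    rw [bco, pow_mul, div_pow (s : ℂ) 2]
    rw [show ((s : ℂ) ^ 2 / 2 ^ 2) ^ a = (1 / 4) ^ a * ((s : ℂ) ^ 2) ^ a by rw [← mul_pow]; congr 1; ring]
    ring
  have sA : Summable (fun a => ‖aco a * ((s : ℂ) ^ 2) ^ a‖) := by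
    simp only [eA]
    exact Summable.of_nonneg_of_le (fun _ => norm_nonneg _) (fun a => norm_sub_le _ _) (s1.add s2)
  have sB : Summable (fun a => ‖bco a * ((s : ℂ) ^ 2) ^ a‖) := by simpa only [eB] using s3
  have eP : ∀ d, ∑ x ∈ Finset.HasAntidiagonal.antidiagonal d, (aco x.1 * ((s : ℂ) ^ 2) ^ x.1) * (bco x.2 * ((s : ℂ) ^ 2) ^ x.2) = pco d * ((s : ℂ) ^ 2) ^ d := by
    intro d
    rw [pco, Finset.sum_mul]
    refine Finset.sum_congr rfl fun x hx => ?_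
    rw [← Finset.HasAntidiagonal.mem_antidiagonal.mp hx, pow_add]; ring
  have h1 := tsum_mul_tsum_eq_tsum_sum_antidiagonal_of_summable_norm sA sB
  have h2 := summable_norm_sum_mul_antidiagonal_of_summable_norm sA sB
  simp only [eP] at h1 h2
  refine ⟨h2, ?_⟩
  rw [← h1]
  simp only [eA, eB]
  rw [s1.of_norm.tsum_sub s2.of_norm, c1, c2, c3]
  have hPF := PF_sin s (fun n hn h => by
    have h3 : tt n = s ^ 2 := by exact_mod_cast h
    have h4 := abs_tt n
    rw [h3, abs_of_nonneg (by positivity)] at h4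
    have h5 : (1 : ℝ) ≤ n := by exact_mod_cast Nat.one_le_iff_ne_zero.mpr hn
    nlinarith)
  have k1 := sin_pi_mul_ne_zero (mem_compl_of_norm _ hz1 hn1)
  have k2 := sin_pi_mul_ne_zero (mem_compl_of_norm _ hz2 hn2)
  have k3 := sin_pi_mul_ne_zero (mem_compl_of_norm _ hz3 hn3)
  have d1 : Complex.sin (Real.pi * (Complex.I * s)) = 2 * Complex.sin (Real.pi * (Complex.I * s / 2)) * Complex.cos (Real.pi * (Complex.I * s / 2)) := by
    rw [← Complex.sin_two_mul]; congr 1; ring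
  have d2 : Complex.cos (Real.pi * (Complex.I * s)) = 1 - 2 * Complex.sin (Real.pi * (Complex.I * s / 2)) ^ 2 := by
    rw [show (Real.pi * (Complex.I * s) : ℂ) = 2 * (Real.pi * (Complex.I * s / 2)) by ring, Complex.cos_two_mul]
    linear_combination 2 * Complex.sin_sq_add_cos_sq (Real.pi * (Complex.I * s / 2))
  have d3 : Complex.sin (Real.pi * s) = 2 * Complex.sin (Real.pi * (s / 2)) * Complex.cos (Real.pi * (s / 2)) := by
    rw [← Complex.sin_two_mul]; congr 1; ring
  have d4 := Complex.sin_sq_add_cos_sq (Real.pi * (Complex.I * s / 2))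
  rw [Complex.cot_eq_cos_div_sin, Complex.cot_eq_cos_div_sin, Complex.cot_eq_cos_div_sin, d2, d1]
  rw [d1, d3] at hPF
  rw [d1] at k2
  have k4 : Complex.cos (Real.pi * (Complex.I * s / 2)) ≠ 0 := right_ne_zero_of_mul k2
  generalize Complex.cos (Real.pi * (Complex.I * s / 2)) = c at *
  generalize Complex.sin (Real.pi * (Complex.I * s / 2)) = t at *
  generalize Complex.cos (Real.pi * (s / 2)) = c' at *
  generalize Complex.sin (Real.pi * (s / 2)) = t' at *
  have hP : PF ((s : ℂ) ^ 2) = -Complex.I * (t / c) * (c' / t') := by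
    field_simp
    have : 2 * t' * t ≠ 0 := by simp [k3, k1]
    apply mul_left_cancel₀ this
    linear_combination hPF
  have hA : -(Real.pi * (Complex.I * s / 2) / 2) * (c / t) - -(Real.pi * (Complex.I * s) / 2) * ((1 - 2 * t ^ 2) / (2 * t * c)) = -(Real.pi * Complex.I * s / 4) * (t / c) := by
    field_simp
    linear_combination -4 * d4
  rw [hP, hA]
  ring

lemma pco_eq : pco 0 = 0 ∧ ∀ d, pco (d + 1) = -(Real.pi ^ 2 / 16) * (Pd d : ℂ) := by
  let e : ℕ → ℂ := fun d => pco d + (if d = 0 then 0 else (Real.pi ^ 2 / 16) * (Pd (d - 1) : ℂ))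
  have key : ∀ N, e N = 0 := by
    have main : ∀ s : ℝ, 0 < s → s < 1 → Summable (fun d => ‖e d * ((s : ℂ) ^ 2) ^ d‖) ∧ ∑' d, e d * ((s : ℂ) ^ 2) ^ d = 0 := by
      intro s h0 h1
      obtain ⟨a1, a2⟩ := pco_series s h0 h1
      obtain ⟨b1, b2⟩ := PF_series ((s : ℂ) ^ 2) (by
        rw [norm_pow, Complex.norm_real, Real.norm_of_nonneg h0.le]; nlinarith)
      have f0 : Summable (fun d : ℕ => ‖(if d = 0 then 0 else (Real.pi ^ 2 / 16) * (Pd (d - 1) : ℂ)) * ((s : ℂ) ^ 2) ^ d‖) := by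
        rw [← summable_nat_add_iff 1]
        refine (b1.mul_left ‖(Real.pi ^ 2 / 16 : ℂ) * (s : ℂ) ^ 2‖).congr fun d => ?_
        rw [← norm_mul, if_neg (by omega), Nat.add_sub_cancel]; congr 1; ring
      have f1 : ∀ d, e d * ((s : ℂ) ^ 2) ^ d = pco d * ((s : ℂ) ^ 2) ^ d + (if d = 0 then 0 else (Real.pi ^ 2 / 16) * (Pd (d - 1) : ℂ)) * ((s : ℂ) ^ 2) ^ d := by
        intro d; simp only [e]; ring
      simp only [f1]
      refine ⟨Summable.of_nonneg_of_le (fun _ => norm_nonneg _) (fun a => norm_add_le _ _) (a1.add f0), ?_⟩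
      rw [a1.of_norm.tsum_add f0.of_norm, a2, f0.of_norm.tsum_eq_zero_add]
      have f2 : ∀ d : ℕ, (if d + 1 = 0 then 0 else (Real.pi ^ 2 / 16) * (Pd (d + 1 - 1) : ℂ)) * ((s : ℂ) ^ 2) ^ (d + 1) =
          (Real.pi ^ 2 / 16 * (s : ℂ) ^ 2) * (Pd d * ((s : ℂ) ^ 2) ^ d) := by
        intro d; rw [if_neg (by omega), Nat.add_sub_cancel]; ring
      rw [tsum_congr f2, tsum_mul_left, b2]; simp
    refine series_unique e (1 / 4) (by norm_num) ?_ ?_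
    · refine (main (1 / 2) (by norm_num) (by norm_num)).1.congr fun d => ?_
      rw [norm_mul, norm_pow, norm_pow, Complex.norm_real]; norm_num
    · intro y hy0 hy1
      have := (main (Real.sqrt y) (Real.sqrt_pos.mpr hy0) (by rw [Real.sqrt_lt' one_pos]; linarith)).2
      rwa [show ((Real.sqrt y : ℝ) : ℂ) ^ 2 = (y : ℂ) by rw [← Complex.ofReal_pow, Real.sq_sqrt hy0.le]] at this
  constructor
  · simpa [e] using key 0
  · intro d
    have := key (d + 1)
    simp only [e, if_neg (Nat.succ_ne_zero d), Nat.add_sub_cancel] at this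
    linear_combination this

/-! ### Summation over the poles -/

lemma tel_sum (φ : ℝ → ℝ) (hodd : ∀ x, φ (-x) = -φ x)
    (h0 : ∀ c : ℝ, Filter.Tendsto (fun K : ℕ => φ (2 * (K : ℝ) + c)) Filter.atTop (nhds 0)) (a : ℝ) (q : ℕ) :
    Filter.Tendsto (fun K : ℕ => ∑ i ∈ Finset.range K, (φ (2 * (i : ℝ) + a - 2 * q) + φ (2 * (i : ℝ) + a + 2 * q) - 2 * φ (2 * (i : ℝ) + a)))
      Filter.atTop (nhds (-∑ p ∈ Finset.range q, (φ (2 * (p : ℝ) + 2 - a) + φ (2 * (p : ℝ) + a)))) := by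
  induction q with
  | zero =>
    refine tendsto_const_nhds.congr fun K => ?_
    simp only [Finset.range_zero, Finset.sum_empty, neg_zero]
    rw [Finset.sum_eq_zero]; intro i _; simp; ring
  | succ q ih =>
    have e : ∀ K : ℕ, ∑ i ∈ Finset.range K, (φ (2 * (i : ℝ) + a - 2 * (q + 1 : ℕ)) + φ (2 * (i : ℝ) + a + 2 * (q + 1 : ℕ)) - 2 * φ (2 * (i : ℝ) + a)) =
        ∑ i ∈ Finset.range K, (φ (2 * (i : ℝ) + a - 2 * q) + φ (2 * (i : ℝ) + a + 2 * q) - 2 * φ (2 * (i : ℝ) + a))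
          + (φ (2 * (K : ℝ) + (a + 2 * q)) - φ (2 * (q : ℝ) + a)) - (φ (2 * (q : ℝ) + 2 - a) + φ (2 * (K : ℝ) + (a - 2 * q - 2))) := by
      intro K
      induction K with
      | zero =>
        simp only [Finset.range_zero, Finset.sum_empty, Nat.cast_zero]
        rw [show (2 * (0 : ℝ) + (a - 2 * q - 2)) = -(2 * (q : ℝ) + 2 - a) by ring, hodd]
        rw [show (2 * (0 : ℝ) + (a + 2 * q)) = (2 * (q : ℝ) + a) by ring]; ring
      | succ K ihK =>
        rw [Finset.sum_range_succ, Finset.sum_range_succ, ihK]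
        push_cast
        rw [show (2 * (K : ℝ) + a - 2 * (q + 1)) = 2 * (K : ℝ) + (a - 2 * q - 2) by ring,
          show (2 * (K : ℝ) + a + 2 * (q + 1)) = 2 * ((K : ℝ) + 1) + (a + 2 * q) by ring,
          show (2 * ((K : ℝ) + 1) + (a - 2 * q - 2)) = 2 * (K : ℝ) + a - 2 * q by ring,
          show (2 * (K : ℝ) + (a + 2 * q)) = 2 * (K : ℝ) + a + 2 * q by ring]
        ring
    have := (ih.add ((h0 (a + 2 * q)).sub_const (φ (2 * (q : ℝ) + a)))).sub ((h0 (a - 2 * q - 2)).const_add (φ (2 * (q : ℝ) + 2 - a)))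
    rw [Finset.sum_range_succ]
    refine (this.congr fun K => (e K).symm).trans_eq ?_
    congr 1; ring

lemma tel_sum' (φ : ℝ → ℝ) (hodd : ∀ x, φ (-x) = -φ x)
    (h0 : ∀ c : ℝ, Filter.Tendsto (fun K : ℕ => φ (2 * (K : ℝ) + c)) Filter.atTop (nhds 0)) (q : ℕ) :
    Filter.Tendsto (fun K : ℕ => ∑ i ∈ Finset.range K, (φ (2 * (i : ℝ) + 1 - 2 * q) + φ (2 * (i : ℝ) + 3 + 2 * q) - 2 * φ (2 * (i : ℝ) + 1)))
      Filter.atTop (nhds (-∑ p ∈ Finset.range q, 2 * φ (2 * (p : ℝ) + 1) - φ (2 * (q : ℝ) + 1))) := by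
  have e : ∀ K : ℕ, ∑ i ∈ Finset.range K, (φ (2 * (i : ℝ) + 1 - 2 * q) + φ (2 * (i : ℝ) + 3 + 2 * q) - 2 * φ (2 * (i : ℝ) + 1)) =
      ∑ i ∈ Finset.range K, (φ (2 * (i : ℝ) + 1 - 2 * q) + φ (2 * (i : ℝ) + 1 + 2 * q) - 2 * φ (2 * (i : ℝ) + 1)) +
        (φ (2 * (K : ℝ) + (1 + 2 * q)) - φ (2 * (q : ℝ) + 1)) := by
    intro K
    induction K with
    | zero => simp; rw [add_comm, sub_self]
    | succ K ihK =>
      rw [Finset.sum_range_succ, Finset.sum_range_succ, ihK]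
      push_cast
      rw [show (2 * (K : ℝ) + 3 + 2 * q) = 2 * ((K : ℝ) + 1) + (1 + 2 * q) by ring,
          show (2 * (K : ℝ) + (1 + 2 * q)) = 2 * (K : ℝ) + 1 + 2 * q by ring]
      ring
  have := (tel_sum φ hodd h0 1 q).add ((h0 (1 + 2 * q)).sub_const (φ (2 * (q : ℝ) + 1)))
  refine (this.congr fun K => (e K).symm).trans_eq ?_
  congr 1
  have : ∀ p : ℕ, φ (2 * (p : ℝ) + 2 - 1) + φ (2 * (p : ℝ) + 1) = 2 * φ (2 * (p : ℝ) + 1) := by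
    intro p; rw [show 2 * (p : ℝ) + 2 - 1 = 2 * p + 1 by ring]; ring
  simp only [this]; ring

lemma lin_tendsto (c : ℝ) : Filter.Tendsto (fun K : ℕ => 2 * (K : ℝ) + c) Filter.atTop Filter.atTop :=
  Filter.tendsto_atTop_add_const_right _ _ (tendsto_natCast_atTop_atTop.const_mul_atTop (by norm_num))

lemma inv_tendsto (c : ℝ) : Filter.Tendsto (fun K : ℕ => (2 * (K : ℝ) + c)⁻¹) Filter.atTop (nhds 0) :=
  tendsto_inv_atTop_zero.comp (lin_tendsto c)

/-- `m / (m^2 + n^2)` -/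
noncomputable def hh (n : ℕ) (x : ℝ) : ℝ := x / (x ^ 2 + (n : ℝ) ^ 2)

lemma hh_odd (n : ℕ) (x : ℝ) : hh n (-x) = -hh n x := by
  rw [hh, hh, neg_sq, neg_div]

lemma hh_tendsto (n : ℕ) (c : ℝ) : Filter.Tendsto (fun K : ℕ => hh n (2 * (K : ℝ) + c)) Filter.atTop (nhds 0) := by
  refine squeeze_zero_norm' ?_ (inv_tendsto c)
  filter_upwards [(lin_tendsto c).eventually_gt_atTop 0] with K hK
  rw [hh, Real.norm_of_nonneg (by positivity), inv_eq_one_div, div_le_div_iff₀ (by positivity) hK]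
  nlinarith [sq_nonneg (n : ℝ)]

/-! bounds -/
lemma abs_tt_add (n k : ℕ) (hn : n ≠ 0) (hk : k ≠ 0) : (n : ℝ) + k ≤ |tt n + tt k| := by
  have hn1 : (1 : ℝ) ≤ n := by exact_mod_cast Nat.one_le_iff_ne_zero.mpr hn
  have hk1 : (1 : ℝ) ≤ k := by exact_mod_cast Nat.one_le_iff_ne_zero.mpr hk
  have hne : ∀ (i j : ℕ), Odd i → Even j → 1 ≤ ((i : ℝ) - j) ^ 2 := by
    intro i j hi hj
    have h1 : (i : ℤ) - j ≠ 0 := by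
      intro h
      have : i = j := by omega
      rw [this] at hi
      exact (Nat.not_even_iff_odd.mpr hi) hj
    have h2 : 1 ≤ ((i : ℤ) - j) ^ 2 := by
      have : 0 < ((i : ℤ) - j) ^ 2 := by positivity
      omega
    exact_mod_cast h2
  have hdiff : ∀ x y : ℝ, 0 ≤ x + y → 1 ≤ (x - y) ^ 2 → x + y ≤ |x ^ 2 - y ^ 2| := by
    intro x y h h2
    rw [show x ^ 2 - y ^ 2 = (x + y) * (x - y) by ring, abs_mul, abs_of_nonneg h]
    have : 1 ≤ |x - y| := by rwa [← one_le_sq_iff_one_le_abs]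
    exact le_mul_of_one_le_right h this
  rw [tt, tt]
  rcases Nat.even_or_odd n with h | h <;> rcases Nat.even_or_odd k with h' | h'
  · rw [h.neg_one_pow, h'.neg_one_pow, abs_of_nonneg (by positivity)]; nlinarith
  · rw [h.neg_one_pow, h'.neg_one_pow]
    have := hdiff k n (by positivity) (hne k n h' h)
    rw [abs_sub_comm] at this
    rw [show 1 * (n : ℝ) ^ 2 + -1 * (k : ℝ) ^ 2 = (n : ℝ) ^ 2 - k ^ 2 by ring]; linarith
  · rw [h.neg_one_pow, h'.neg_one_pow]
    have := hdiff n k (by positivity) (hne n k h h')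
    rw [abs_sub_comm] at this
    rw [show -1 * (n : ℝ) ^ 2 + 1 * (k : ℝ) ^ 2 = (k : ℝ) ^ 2 - n ^ 2 by ring]; linarith
  · rw [h.neg_one_pow, h'.neg_one_pow, show -1 * (n : ℝ) ^ 2 + -1 * (k : ℝ) ^ 2 = -((n : ℝ) ^ 2 + k ^ 2) by ring, abs_neg,
      abs_of_nonneg (by positivity)]; nlinarith

lemma mu_div_eq (n k : ℕ) (hn : n ≠ 0) (hk : k ≠ 0) : mu n / (mu n + mu k) = tt k / (tt n + tt k) := by
  have h1 := tt_ne hn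
  have h2 := tt_ne hk
  have h3 := tt_add_ne (i := n) hk
  have h4 : tt k + tt n ≠ 0 := by rwa [add_comm]
  rw [mu_eq, mu_eq]
  field_simp
  ring

lemma mu_div_bound (n k : ℕ) (hk : k ≠ 0) : |mu n / (mu n + mu k)| ≤ k := by
  rcases Nat.eq_zero_or_pos n with rfl | hn
  · simp [mu_zero]
  · have hn' : n ≠ 0 := by omega
    rw [mu_div_eq n k hn' hk, abs_div, abs_tt]
    have h := abs_tt_add n k hn' hk
    have hk1 : (1 : ℝ) ≤ k := by exact_mod_cast Nat.one_le_iff_ne_zero.mpr hk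
    have hn1 : (0 : ℝ) < n := by exact_mod_cast hn
    rw [div_le_iff₀ (by linarith)]
    nlinarith

lemma mu_div_bound2 (n k : ℕ) : |mu n / (mu n ^ 2 + 1 / (4 * (k : ℝ) ^ 4))| ≤ (k : ℝ) ^ 2 ∨ k = 0 := by
  rcases Nat.eq_zero_or_pos k with rfl | hk
  · right; rfl
  · left
    have hk0 : (0 : ℝ) < k := by exact_mod_cast hk
    rw [abs_div, abs_of_pos (a := mu n ^ 2 + 1 / (4 * (k : ℝ) ^ 4)) (by positivity), div_le_iff₀ (by positivity), ← sq_abs (mu n)]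
    have : (k : ℝ) ^ 2 * (|mu n| ^ 2 + 1 / (4 * (k : ℝ) ^ 4)) - |mu n| = (k * |mu n| - 1 / (2 * (k : ℝ))) ^ 2 := by
      field_simp; ring
    nlinarith [sq_nonneg (k * |mu n| - 1 / (2 * (k : ℝ)))]

/-- the two kernels -/
noncomputable def fk (n k : ℕ) : ℝ := 8 * (-1) ^ k / (k : ℝ) ^ 3 * (mu n / (mu n + mu k))
noncomputable def gk (n k : ℕ) : ℝ := 1 / (k : ℝ) ^ 5 * (mu n / (mu n ^ 2 + 1 / (4 * (k : ℝ) ^ 4)))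

lemma fk_bound (n k : ℕ) : |fk n k| ≤ 8 * (1 / (k : ℝ) ^ 2) := by
  rcases Nat.eq_zero_or_pos k with rfl | hk
  · simp [fk]
  · have hk0 : (0 : ℝ) < k := by exact_mod_cast hk
    rw [fk, abs_mul, abs_div, abs_mul, abs_pow, abs_neg, abs_one, one_pow, mul_one, abs_of_pos (a := (k : ℝ) ^ 3) (by positivity)]
    have := mu_div_bound n k (by omega)
    calc |8| / (k : ℝ) ^ 3 * |mu n / (mu n + mu k)| ≤ |8| / (k : ℝ) ^ 3 * k := by gcongr
      _ = _ := by rw [abs_of_pos (by norm_num)]; field_simp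

lemma gk_bound (n k : ℕ) : |gk n k| ≤ 1 / (k : ℝ) ^ 2 := by
  rcases mu_div_bound2 n k with h | rfl
  · rcases Nat.eq_zero_or_pos k with rfl | hk
    · simp [gk]
    have hk0 : (1 : ℝ) ≤ k := by exact_mod_cast hk
    have hk1 : (0 : ℝ) < k := by linarith
    rw [gk, abs_mul, abs_of_pos (a := 1 / (k : ℝ) ^ 5) (by positivity)]
    calc 1 / (k : ℝ) ^ 5 * |mu n / (mu n ^ 2 + 1 / (4 * (k : ℝ) ^ 4))| ≤ 1 / (k : ℝ) ^ 5 * (k : ℝ) ^ 2 := by gcongr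
      _ = 1 / (k : ℝ) ^ 3 := by field_simp
      _ ≤ _ := by
        gcongr 1 / ?_
        exact pow_le_pow_right₀ hk0 (by norm_num)
  · simp [gk]

lemma fk_summable (n : ℕ) : Summable (fun k => fk n k) :=
  Summable.of_norm_bounded (sum_inv_sq.mul_left 8) (fun k => fk_bound n k)
lemma gk_summable (n : ℕ) : Summable (fun k => gk n k) :=
  Summable.of_norm_bounded sum_inv_sq (fun k => gk_bound n k)

lemma fk_eq (n k : ℕ) (hn : n ≠ 0) (hk : k ≠ 0) : fk n k = 8 / k / (tt n + tt k) := by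
  rw [fk, mu_div_eq n k hn hk]
  have h3 := tt_add_ne (i := n) hk
  have hk0 : (k : ℝ) ≠ 0 := by exact_mod_cast hk
  rw [show tt k / (tt n + tt k) = ((-1) ^ k * (k : ℝ) ^ 2) / (tt n + tt k) by rfl]
  field_simp
  have := neg_one_sq' k
  linear_combination this

lemma fk_same (n k : ℕ) (hn : n ≠ 0) (hk : k ≠ 0) (h : (-1 : ℝ) ^ k = (-1) ^ n) :
    fk n k = mu n * (8 * ((k : ℝ)⁻¹ - hh n k)) := by
  rw [fk_eq n k hn hk, hh, mu, tt, tt, h]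
  have hk0 : (k : ℝ) ≠ 0 := by exact_mod_cast hk
  have hn0 : (n : ℝ) ≠ 0 := by exact_mod_cast hn
  have hs : (k : ℝ) ^ 2 + (n : ℝ) ^ 2 ≠ 0 := by positivity
  have hs' : (n : ℝ) ^ 2 + (k : ℝ) ^ 2 ≠ 0 := by positivity
  have he := neg_one_sq' n
  have he0 : (-1 : ℝ) ^ n ≠ 0 := by simp
  generalize (-1 : ℝ) ^ n = e at *
  rw [← mul_add]
  field_simp
  linear_combination (-(n : ℝ) ^ 2 * ((n : ℝ) ^ 2 + (k : ℝ) ^ 2)) * he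

lemma fk_diff (n k : ℕ) (hn : n ≠ 0) (hk : k ≠ 0) (h : (-1 : ℝ) ^ k = -(-1) ^ n) :
    fk n k = mu n * (8 * ((k : ℝ)⁻¹ - (((k : ℝ) - n)⁻¹ + ((k : ℝ) + n)⁻¹) / 2)) := by
  have hk0 : (k : ℝ) ≠ 0 := by exact_mod_cast hk
  have hn0 : (n : ℝ) ≠ 0 := by exact_mod_cast hn
  have he := neg_one_sq' n
  have he0 : (-1 : ℝ) ^ n ≠ 0 := by simp
  have h1 : (k : ℝ) - n ≠ 0 := by
    intro h2
    have : k = n := by exact_mod_cast sub_eq_zero.mp h2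
    rw [this] at h
    apply he0; linarith
  have h2 : (k : ℝ) + n ≠ 0 := by positivity
  have h3 : (n : ℝ) - k ≠ 0 := by intro h; apply h1; linarith
  have h4 : (n : ℝ) + k ≠ 0 := by positivity
  rw [fk_eq n k hn hk, mu, tt, tt, h]
  generalize (-1 : ℝ) ^ n = e at *
  rw [show e * (n : ℝ) ^ 2 + -e * (k : ℝ) ^ 2 = -(e * ((k - n) * (k + n))) by ring]
  field_simp
  linear_combination (2 * (n : ℝ) ^ 2) * he

lemma gk_eq (n k : ℕ) (hn : n ≠ 0) (hk : k ≠ 0) :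
    gk n k = mu n * (4 * ((k : ℝ)⁻¹ - (hh n (2 * k - n) + hh n (2 * k + n)))) := by
  have hk0 : (k : ℝ) ≠ 0 := by exact_mod_cast hk
  have hn0 : (n : ℝ) ≠ 0 := by exact_mod_cast hn
  have e1 : hh n (2 * k - n) + hh n (2 * k + n) = 4 * (k : ℝ) ^ 3 / (4 * (k : ℝ) ^ 4 + (n : ℝ) ^ 4) := by
    rw [hh, hh]
    have h1 : (2 * (k : ℝ) - n) ^ 2 + (n : ℝ) ^ 2 ≠ 0 := by positivity
    have h2 : (2 * (k : ℝ) + n) ^ 2 + (n : ℝ) ^ 2 ≠ 0 := by positivity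
    have h3 : 4 * (k : ℝ) ^ 4 + (n : ℝ) ^ 4 ≠ 0 := by positivity
    rw [div_add_div _ _ h1 h2, div_eq_div_iff (mul_ne_zero h1 h2) h3]
    ring
  have e2 : mu n ^ 2 = 1 / (n : ℝ) ^ 4 := by
    rw [mu, div_pow, pow_two, neg_one_sq']; ring
  have h3 : 4 * (k : ℝ) ^ 4 + (n : ℝ) ^ 4 ≠ 0 := by positivity
  have e3 : 1 / (n : ℝ) ^ 4 + 1 / (4 * (k : ℝ) ^ 4) = (4 * (k : ℝ) ^ 4 + (n : ℝ) ^ 4) / (4 * (k : ℝ) ^ 4 * (n : ℝ) ^ 4) := by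
    field_simp
  rw [gk, e1, e2, e3]
  field_simp
  ring

lemma SS_odd (q : ℕ) : SS (2 * q + 1) = 4 * ∑ i ∈ Finset.range q, ((2 * (i : ℝ) + 1)⁻¹ - hh (2 * q + 1) (2 * i + 1)) + (2 * (q : ℝ) + 1)⁻¹ := by
  rw [SS, Odd.neg_one_pow ⟨q, rfl⟩]
  have hq : (0 : ℝ) < 2 * q + 1 := by positivity
  have := TT_odd q (((2 * q + 1 : ℕ) : ℝ) ^ 2) (by positivity)
  rw [this, Finset.mul_sum, Finset.mul_sum]
  have e : ∀ i : ℕ, ((2 * (q : ℝ) + 1) ^ 2 + ((2 * q + 1 : ℕ) : ℝ) ^ 2) * (2 / ((2 * (i : ℝ) + 1) * ((2 * (i : ℝ) + 1) ^ 2 + ((2 * q + 1 : ℕ) : ℝ) ^ 2)))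
      = 4 * ((2 * (i : ℝ) + 1)⁻¹ - hh (2 * q + 1) (2 * i + 1)) := by
    intro i
    have hi : (2 * (i : ℝ) + 1) ≠ 0 := by positivity
    rw [hh]; push_cast
    have : (2 * (i : ℝ) + 1) ^ 2 + (2 * (q : ℝ) + 1) ^ 2 ≠ 0 := by positivity
    field_simp
    ring
  rw [Finset.sum_congr rfl fun i _ => e i]
  rw [inv_eq_one_div]; ring

lemma SS_even (q : ℕ) : SS (2 * q + 2) = 4 * (∑ i ∈ Finset.range (q + 1), (2 * (i : ℝ) + 1)⁻¹ - ∑ i ∈ Finset.range q, hh (2 * q + 2) (2 * i + 2)) - (2 * (q : ℝ) + 2)⁻¹ := by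
  rw [SS, Even.neg_one_pow ⟨q + 1, by ring⟩]
  have hq : (2 * (q : ℝ) + 2) ≠ 0 := by positivity
  have := TT_even q (((2 * q + 2 : ℕ) : ℝ) ^ 2) (by positivity)
  rw [this]
  have e : ∀ i : ℕ, (2 * (i : ℝ) + 2) / ((2 * (i : ℝ) + 2) ^ 2 + ((2 * q + 2 : ℕ) : ℝ) ^ 2)
      = hh (2 * q + 2) (2 * i + 2) := fun i => rfl
  rw [Finset.sum_congr rfl fun i _ => e i]
  simp only [one_div]
  push_cast
  generalize ∑ i ∈ Finset.range q, hh (2 * q + 2) (2 * i + 2) = X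
  generalize ∑ i ∈ Finset.range (q + 1), (2 * (i : ℝ) + 1)⁻¹ = Y
  field_simp
  ring

lemma sum_pair (f g : ℕ → ℝ) (hf0 : f 0 = 0) (hg0 : g 0 = 0) (hf : Summable f) (hg : Summable g) :
    Filter.Tendsto (fun K : ℕ => ∑ i ∈ Finset.range K, (f (2 * i + 1) + f (2 * i + 2) - g (i + 1))) Filter.atTop
      (nhds (∑' k, f k - ∑' k, g k)) := by
  have h1 : Filter.Tendsto (fun K : ℕ => 2 * K + 1) Filter.atTop Filter.atTop :=
    Filter.tendsto_atTop_mono (fun K => show K ≤ 2 * K + 1 by omega) Filter.tendsto_id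
  have h := (hf.hasSum.tendsto_sum_nat.comp h1).sub (hg.hasSum.tendsto_sum_nat.comp (Filter.tendsto_add_atTop_nat 1))
  refine h.congr fun K => ?_
  simp only [Function.comp]
  induction K with
  | zero => simp [hf0, hg0]
  | succ K ih =>
    rw [Finset.sum_range_succ _ K, ← ih, show 2 * (K + 1) + 1 = 2 * K + 1 + 1 + 1 by ring, Finset.sum_range_succ _ (2 * K + 1 + 1),
      Finset.sum_range_succ _ (2 * K + 1), Finset.sum_range_succ g (K + 1)]
    ring

lemma bracket (n : ℕ) (hn : n ≠ 0) : ∑' k, fk n k - ∑' k, gk n k = 2 * mu n * SS n := by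
  have h := sum_pair (fk n) (gk n) (by simp [fk]) (by simp [gk]) (fk_summable n) (gk_summable n)
  refine tendsto_nhds_unique h ?_
  have iodd : ∀ x : ℝ, (-x)⁻¹ = -x⁻¹ := fun x => inv_neg
  rcases Nat.even_or_odd' n with ⟨q, rfl | rfl⟩
  · obtain ⟨q, rfl⟩ : ∃ q', q = q' + 1 := ⟨q - 1, by omega⟩
    have hp : (-1 : ℝ) ^ (2 * (q + 1)) = 1 := Even.neg_one_pow ⟨q + 1, by ring⟩
    have A1 := tel_sum (fun x => x⁻¹) iodd inv_tendsto 1 (q + 1)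
    have A2 := tel_sum (hh (2 * (q + 1))) (hh_odd _) (hh_tendsto _) 2 (q + 1)
    have A := ((A2.sub A1).const_mul 4).const_mul (mu (2 * (q + 1)))
    refine (A.congr fun K => ?_).trans_eq ?_
    · rw [← Finset.sum_sub_distrib, Finset.mul_sum, Finset.mul_sum]
      refine Finset.sum_congr rfl fun i _ => ?_
      rw [fk_diff _ _ hn (by omega) (by rw [hp]; exact Odd.neg_one_pow ⟨i, rfl⟩),
        fk_same _ _ hn (by omega) (by rw [hp]; exact Even.neg_one_pow ⟨i + 1, by ring⟩), gk_eq _ _ hn (by omega)]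
      push_cast
      rw [show 2 * ((i : ℝ) + 1) - 2 * (q + 1) = 2 * (i : ℝ) + 2 - 2 * (q + 1) by ring,
        show 2 * ((i : ℝ) + 1) + 2 * (q + 1) = 2 * (i : ℝ) + 2 + 2 * (q + 1) by ring,
        show (2 * (i : ℝ) + 2)⁻¹ = ((i : ℝ) + 1)⁻¹ / 2 by rw [show 2 * (i : ℝ) + 2 = 2 * (i + 1) by ring, mul_inv]; ring]
      ring
    · congr 1
      have e1 : ∑ p ∈ Finset.range (q + 1), ((2 * (p : ℝ) + 2 - 1)⁻¹ + (2 * (p : ℝ) + 1)⁻¹) = 2 * ∑ p ∈ Finset.range (q + 1), (2 * (p : ℝ) + 1)⁻¹ := by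
        rw [Finset.mul_sum]; refine Finset.sum_congr rfl fun p _ => ?_
        rw [show 2 * (p : ℝ) + 2 - 1 = 2 * p + 1 by ring]; ring
      have e2 : ∑ p ∈ Finset.range (q + 1), (hh (2 * (q + 1)) (2 * (p : ℝ) + 2 - 2) + hh (2 * (q + 1)) (2 * (p : ℝ) + 2)) =
          2 * ∑ p ∈ Finset.range q, hh (2 * (q + 1)) (2 * (p : ℝ) + 2) + (2 * (q : ℝ) + 2)⁻¹ / 2 := by
        rw [Finset.sum_add_distrib, Finset.sum_range_succ', Finset.sum_range_succ]
        have z1 : hh (2 * (q + 1)) (2 * ((0 : ℕ) : ℝ) + 2 - 2) = 0 := by simp [hh]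
        have z2 : hh (2 * (q + 1)) (2 * (q : ℝ) + 2) = (2 * (q : ℝ) + 2)⁻¹ / 2 := by
          rw [hh]; push_cast
          have hq : (2 * (q : ℝ) + 2) ≠ 0 := by positivity
          rw [show 2 * ((q : ℝ) + 1) = 2 * q + 2 by ring]
          field_simp; ring
        have z3 : ∀ p : ℕ, 2 * ((p + 1 : ℕ) : ℝ) + 2 - 2 = 2 * p + 2 := by intro p; push_cast; ring
        simp only [z1, z2, z3]; ring
      simp only [e1, e2]
      rw [show 2 * (q + 1) = 2 * q + 2 by ring, SS_even]
      ring
  · have hp : (-1 : ℝ) ^ (2 * q + 1) = -1 := Odd.neg_one_pow ⟨q, by ring⟩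
    have A1 := tel_sum' (fun x => x⁻¹) iodd inv_tendsto q
    have A2 := tel_sum' (hh (2 * q + 1)) (hh_odd _) (hh_tendsto _) q
    have A := ((A2.sub A1).const_mul 4).const_mul (mu (2 * q + 1))
    refine (A.congr fun K => ?_).trans_eq ?_
    · rw [← Finset.sum_sub_distrib, Finset.mul_sum, Finset.mul_sum]
      refine Finset.sum_congr rfl fun i _ => ?_
      rw [fk_same _ (2 * i + 1) hn (by omega) (by rw [hp]; exact Odd.neg_one_pow ⟨i, rfl⟩),
        fk_diff _ (2 * i + 2) hn (by omega) (by rw [hp, neg_neg]; exact Even.neg_one_pow ⟨i + 1, by ring⟩), gk_eq _ _ hn (by omega)]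
      push_cast
      rw [show 2 * ((i : ℝ) + 1) - (2 * q + 1) = 2 * (i : ℝ) + 1 - 2 * q by ring,
        show 2 * (i : ℝ) + 2 - (2 * q + 1) = 2 * (i : ℝ) + 1 - 2 * q by ring,
        show 2 * ((i : ℝ) + 1) + (2 * q + 1) = 2 * (i : ℝ) + 3 + 2 * q by ring,
        show 2 * (i : ℝ) + 2 + (2 * q + 1) = 2 * (i : ℝ) + 3 + 2 * q by ring,
        show (2 * (i : ℝ) + 2)⁻¹ = ((i : ℝ) + 1)⁻¹ / 2 by rw [show 2 * (i : ℝ) + 2 = 2 * (i + 1) by ring, mul_inv]; ring]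
      ring
    · congr 1
      have z2 : hh (2 * q + 1) (2 * (q : ℝ) + 1) = (2 * (q : ℝ) + 1)⁻¹ / 2 := by
          rw [hh]; push_cast
          have hq : (2 * (q : ℝ) + 1) ≠ 0 := by positivity
          field_simp; ring
      rw [SS_odd, z2, ← Finset.mul_sum, ← Finset.mul_sum, Finset.sum_sub_distrib]
      ring

lemma geo_lemma (κ x P : ℕ → ℝ) (ξ : ℝ) (hx : ∀ n, |x n| ≤ 1) (hne : ∀ n, x n ≠ 0 → x n - ξ ≠ 0)
    (hQ : 2 * ∑' n, κ n * (x n / (x n - ξ)) = 1) (hP0 : P 0 = 1) (hP : ∀ m, P (m + 1) = 2 * ∑' n, κ n * x n ^ (m + 1)) (m : ℕ) :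
    ∑ c ∈ Finset.range (m + 1), P (m - c) * ξ ^ c = 2 * ∑' n, κ n * x n ^ m * (x n / (x n - ξ)) := by
  have hs0 : Summable (fun n => κ n * (x n / (x n - ξ))) := by
    by_contra h
    rw [tsum_eq_zero_of_not_summable h] at hQ; norm_num at hQ
  have hs : ∀ m, Summable (fun n => κ n * x n ^ m * (x n / (x n - ξ))) := by
    intro m
    refine Summable.of_norm_bounded hs0.norm fun n => ?_
    rw [show κ n * x n ^ m * (x n / (x n - ξ)) = x n ^ m * (κ n * (x n / (x n - ξ))) by ring, norm_mul, norm_pow]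
    exact mul_le_of_le_one_left (norm_nonneg _) (pow_le_one₀ (norm_nonneg _) (hx n))
  induction m with
  | zero => simp [hP0, hQ]
  | succ m ih =>
    rw [Finset.sum_range_succ']
    have e1 : ∑ c ∈ Finset.range (m + 1), P (m + 1 - (c + 1)) * ξ ^ (c + 1) = ξ * ∑ c ∈ Finset.range (m + 1), P (m - c) * ξ ^ c := by
      rw [Finset.mul_sum]; refine Finset.sum_congr rfl fun c _ => ?_
      rw [Nat.add_sub_add_right]; ring
    rw [e1, ih, Nat.sub_zero, hP, pow_zero, mul_one]
    have e2 : ∀ n, κ n * x n ^ (m + 1) = κ n * x n ^ (m + 1) * (x n / (x n - ξ)) - ξ * (κ n * x n ^ m * (x n / (x n - ξ))) := by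
      intro n
      by_cases h : x n = 0
      · simp [h]
      · have := hne n h
        field_simp
        ring
    have e3 : ∑' n, κ n * x n ^ (m + 1) = ∑' n, κ n * x n ^ (m + 1) * (x n / (x n - ξ)) - ξ * ∑' n, κ n * x n ^ m * (x n / (x n - ξ)) := by
      rw [tsum_congr e2, (hs (m + 1)).tsum_sub ((hs m).mul_left ξ), tsum_mul_left]
    rw [e3]; ring

lemma mu_ne_zero_imp {n : ℕ} (h : mu n ≠ 0) : n ≠ 0 := by
  rintro rfl; exact h mu_zero

lemma geo1 (k : ℕ) (hk : k ≠ 0) (m : ℕ) :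
    ∑ c ∈ Finset.range (m + 1), Pd (m - c) * (-mu k) ^ c = 2 * ∑' n, kap n * mu n ^ m * (mu n / (mu n + mu k)) := by
  have := geo_lemma kap mu Pd (-mu k) abs_mu_le
    (fun n h => by rw [sub_neg_eq_add]; exact mu_add_ne hk (mu_ne_zero_imp h))
    (by simp only [sub_neg_eq_add]; exact kap_Q1 k hk) (by simp [Pd]) (fun m => by simp [Pd]) m
  simpa only [sub_neg_eq_add] using this

lemma geo2 (k : ℕ) (hk : k ≠ 0) (m : ℕ) :
    ∑ c ∈ Finset.range (m + 1), Pd (2 * (m - c)) * (-(1 / (4 * (k : ℝ) ^ 4))) ^ c =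
      2 * ∑' n, kap n * (mu n ^ 2) ^ m * (mu n ^ 2 / (mu n ^ 2 + 1 / (4 * (k : ℝ) ^ 4))) := by
  have := geo_lemma kap (fun n => mu n ^ 2) (fun j => Pd (2 * j)) (-(1 / (4 * (k : ℝ) ^ 4)))
    (fun n => by rw [abs_pow]; exact pow_le_one₀ (abs_nonneg _) (abs_mu_le n))
    (fun n h => by rw [sub_neg_eq_add]; positivity)
    (by simp only [sub_neg_eq_add]; exact kap_Q2 k hk) (by simp [Pd]) (fun m => by
      rw [Pd, if_neg (by omega)]; simp only [pow_mul]) m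
  simpa only [sub_neg_eq_add] using this

noncomputable def G0 (c : ℕ) : ℝ := ∑' k : ℕ, 8 * (-1) ^ k / (k : ℝ) ^ 3 * (-mu k) ^ c
noncomputable def E1 (j : ℕ) : ℝ := ∑' k : ℕ, -(1 / (k : ℝ) ^ 5) * (-(1 / (4 * (k : ℝ) ^ 4))) ^ j

lemma inv_pow_le (k s : ℕ) (hs : 2 ≤ s) : 1 / (k : ℝ) ^ s ≤ 1 / (k : ℝ) ^ 2 := by
  rcases Nat.eq_zero_or_pos k with rfl | hk
  · simp [show s ≠ 0 by omega]
  · have h1 : (1 : ℝ) ≤ k := by exact_mod_cast hk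
    gcongr 1 / ?_
    exact pow_le_pow_right₀ h1 hs

lemma G0_summable (c : ℕ) : Summable (fun k : ℕ => 8 * (-1) ^ k / (k : ℝ) ^ 3 * (-mu k) ^ c) := by
  refine Summable.of_norm_bounded (sum_inv_sq.mul_left 8) fun k => ?_
  rw [norm_mul, norm_div, norm_mul, norm_pow, norm_neg, norm_one, one_pow, mul_one, norm_pow, norm_pow, norm_neg]
  have h1 : ‖mu k‖ ^ c ≤ 1 := pow_le_one₀ (norm_nonneg _) (abs_mu_le k)
  have h2 := inv_pow_le k 3 (by norm_num)
  rw [Real.norm_natCast]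
  calc ‖(8 : ℝ)‖ / (k : ℝ) ^ 3 * ‖mu k‖ ^ c ≤ ‖(8 : ℝ)‖ / (k : ℝ) ^ 3 * 1 := by gcongr
    _ = 8 * (1 / (k : ℝ) ^ 3) := by rw [Real.norm_of_nonneg (by norm_num)]; ring
    _ ≤ _ := by gcongr 8 * ?_

lemma E1_summable (j : ℕ) : Summable (fun k : ℕ => -(1 / (k : ℝ) ^ 5) * (-(1 / (4 * (k : ℝ) ^ 4))) ^ j) := by
  refine Summable.of_norm_bounded sum_inv_sq fun k => ?_
  rw [norm_mul, norm_neg, norm_pow, norm_neg, Real.norm_of_nonneg (by positivity), Real.norm_of_nonneg (by positivity)]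
  have h1 : (1 / (4 * (k : ℝ) ^ 4)) ^ j ≤ 1 := by
    refine pow_le_one₀ (by positivity) ?_
    rcases Nat.eq_zero_or_pos k with rfl | hk
    · simp
    · have h1 : (1 : ℝ) ≤ (k : ℝ) ^ 4 := one_le_pow₀ (by exact_mod_cast hk)
      rw [div_le_one (by positivity)]; linarith
  have h2 := inv_pow_le k 5 (by norm_num)
  calc 1 / (k : ℝ) ^ 5 * (1 / (4 * (k : ℝ) ^ 4)) ^ j ≤ 1 / (k : ℝ) ^ 5 * 1 := by gcongr
    _ ≤ _ := by rw [mul_one]; exact h2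

lemma kap_mu_abs (n d : ℕ) : |kap n * mu n ^ (d + 1)| ≤ 1 / (n : ℝ) ^ 2 := by
  have := kap_mu_norm n d
  rwa [← Complex.ofReal_pow, ← Complex.ofReal_mul, Complex.norm_real, Real.norm_eq_abs] at this

lemma swap_sum (h : ℕ → ℕ → ℝ) (C : ℝ) (hb : ∀ n k, |h n k| ≤ C * (1 / (k : ℝ) ^ 2)) (d : ℕ) :
    ∑' k, ∑' n, kap n * mu n ^ (d + 1) * h n k = ∑' n, kap n * mu n ^ (d + 1) * ∑' k, h n k := by
  have hF : Summable (fun p : ℕ × ℕ => kap p.1 * mu p.1 ^ (d + 1) * h p.1 p.2) := by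
    refine Summable.of_norm_bounded (sum_inv_sq.mul_of_nonneg (sum_inv_sq.mul_left |C|) (fun _ => by positivity) (fun _ => by positivity)) fun p => ?_
    rw [norm_mul]
    refine mul_le_mul (kap_mu_abs _ _) ?_ (norm_nonneg _) (by positivity)
    refine (hb _ _).trans ?_
    gcongr
    exact le_abs_self C
  rw [Summable.tsum_comm (f := fun n k : ℕ => kap n * mu n ^ (d + 1) * h n k) hF]
  exact tsum_congr fun n => tsum_mul_left

lemma main_G0 (r : ℕ) : ∑ c ∈ Finset.range (2 * r + 2), Pd (2 * r + 1 - c) * G0 c = 2 * ∑' n, kap n * mu n ^ (2 * r + 1) * ∑' k, fk n k := by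
  rw [← swap_sum fk 8 fk_bound (2 * r)]
  have e1 : ∀ c, Pd (2 * r + 1 - c) * G0 c = ∑' k : ℕ, Pd (2 * r + 1 - c) * (8 * (-1) ^ k / (k : ℝ) ^ 3 * (-mu k) ^ c) := by
    intro c; rw [tsum_mul_left]; rfl
  rw [Finset.sum_congr rfl fun c _ => e1 c, ← Summable.tsum_finsetSum (fun c _ => (G0_summable c).mul_left _), ← tsum_mul_left]
  refine tsum_congr fun k => ?_
  by_cases hk : k = 0
  · subst hk; simp [fk]
  · have e2 : ∀ c, Pd (2 * r + 1 - c) * (8 * (-1) ^ k / (k : ℝ) ^ 3 * (-mu k) ^ c) = 8 * (-1) ^ k / (k : ℝ) ^ 3 * (Pd (2 * r + 1 - c) * (-mu k) ^ c) := by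
      intro c; ring
    rw [Finset.sum_congr rfl fun c _ => e2 c, ← Finset.mul_sum, geo1 k hk (2 * r + 1), ← mul_assoc, mul_comm _ (2 : ℝ), mul_assoc, ← tsum_mul_left]
    congr 1
    refine tsum_congr fun n => ?_
    rw [fk]; ring

lemma main_E1 (r : ℕ) : ∑ j ∈ Finset.range (r + 1), Pd (2 * (r - j)) * E1 j = -(2 * ∑' n, kap n * mu n ^ (2 * r + 1) * ∑' k, gk n k) := by
  rw [← swap_sum gk 1 (fun n k => by rw [one_mul]; exact gk_bound n k) (2 * r)]
  have e1 : ∀ c, Pd (2 * (r - c)) * E1 c = ∑' k : ℕ, Pd (2 * (r - c)) * (-(1 / (k : ℝ) ^ 5) * (-(1 / (4 * (k : ℝ) ^ 4))) ^ c) := by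
    intro c; rw [tsum_mul_left]; rfl
  rw [Finset.sum_congr rfl fun c _ => e1 c, ← Summable.tsum_finsetSum (fun c _ => (E1_summable c).mul_left _), ← tsum_mul_left, ← tsum_neg]
  refine tsum_congr fun k => ?_
  by_cases hk : k = 0
  · subst hk; simp [gk]
  · have e2 : ∀ c, Pd (2 * (r - c)) * (-(1 / (k : ℝ) ^ 5) * (-(1 / (4 * (k : ℝ) ^ 4))) ^ c) = -(1 / (k : ℝ) ^ 5) * (Pd (2 * (r - c)) * (-(1 / (4 * (k : ℝ) ^ 4))) ^ c) := by
      intro c; ring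
    rw [Finset.sum_congr rfl fun c _ => e2 c, ← Finset.mul_sum, geo2 k hk r, neg_mul, ← mul_assoc, mul_comm _ (2 : ℝ), mul_assoc, ← tsum_mul_left]
    congr 2
    refine tsum_congr fun n => ?_
    rw [gk]; ring

noncomputable def Gr (c : ℕ) : ℝ := G0 c + if Odd c then E1 (c / 2) else 0

lemma odd_sum (F : ℕ → ℝ) (r : ℕ) : ∑ c ∈ Finset.range (2 * r + 2), (if Odd c then F c else 0) = ∑ j ∈ Finset.range (r + 1), F (2 * j + 1) := by
  induction r with
  | zero => simp [Finset.sum_range_succ]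
  | succ r ih =>
    rw [Finset.sum_range_succ _ (r + 1), ← ih, show 2 * (r + 1) + 2 = 2 * r + 2 + 1 + 1 by ring, Finset.sum_range_succ, Finset.sum_range_succ _ (2 * r + 2)]
    rw [if_neg (by rw [Nat.not_odd_iff_even]; exact ⟨r + 1, by ring⟩), if_pos (by exact ⟨r + 1, by ring⟩), add_zero]
    rfl

lemma main_sum (r : ℕ) : ∑ c ∈ Finset.range (2 * r + 2), Pd (2 * r + 1 - c) * Gr c = 2 * zetaStar (Fin.cons 2 (Fin.cons 3 (pat13 r))) := by
  have e : ∀ c, Pd (2 * r + 1 - c) * Gr c = Pd (2 * r + 1 - c) * G0 c + if Odd c then Pd (2 * r + 1 - c) * E1 (c / 2) else 0 := by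
    intro c; rw [Gr]; split_ifs <;> ring
  rw [Finset.sum_congr rfl fun c _ => e c, Finset.sum_add_distrib, main_G0, odd_sum (fun c => Pd (2 * r + 1 - c) * E1 (c / 2))]
  have e2 : ∀ j, Pd (2 * r + 1 - (2 * j + 1)) * E1 ((2 * j + 1) / 2) = Pd (2 * (r - j)) * E1 j := by
    intro j; rw [show 2 * r + 1 - (2 * j + 1) = 2 * (r - j) by omega, show (2 * j + 1) / 2 = j by omega]
  rw [Finset.sum_congr rfl fun c _ => e2 c, main_E1, zetaStar_eq_kap, ← sub_eq_add_neg, ← mul_sub]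
  have sm : ∀ (h : ℕ → ℕ → ℝ) (C : ℝ), (∀ n k, |h n k| ≤ C * (1 / (k : ℝ) ^ 2)) → Summable (fun n => kap n * mu n ^ (2 * r + 1) * ∑' k, h n k) := by
    intro h C hb
    refine Summable.of_norm_bounded (sum_inv_sq.mul_right (C * ∑' k : ℕ, 1 / (k : ℝ) ^ 2)) fun n => ?_
    rw [norm_mul]
    refine mul_le_mul (kap_mu_abs _ _) ?_ (norm_nonneg _) (by positivity)
    exact tsum_of_norm_bounded (sum_inv_sq.hasSum.mul_left C) (fun k => hb n k)
  rw [← (sm fk 8 fk_bound).tsum_sub (sm gk 1 (fun n k => by rw [one_mul]; exact gk_bound n k))]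
  congr 1
  rw [← tsum_mul_left]
  refine tsum_congr fun n => ?_
  rw [← mul_sub]
  by_cases hn : n = 0
  · subst hn; simp [mu_zero]
  · rw [bracket n hn]; ring

/-! ### Identification with zeta values and conclusion -/

noncomputable def ZZ (s : ℕ) : ℝ := ∑' k : ℕ, 1 / (k : ℝ) ^ s

lemma ZZ_summable (s : ℕ) (hs : 2 ≤ s) : Summable (fun k : ℕ => 1 / (k : ℝ) ^ s) :=
  Real.summable_one_div_nat_pow.mpr (by omega)

lemma zeta_ZZ (c : ℕ) : riemannZeta (2 * (c : ℂ) + 3) = (ZZ (2 * c + 3) : ℂ) := by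
  have h := zeta_nat_eq_tsum_of_gt_one (k := 2 * c + 3) (by omega)
  rw [show (2 * (c : ℂ) + 3) = ((2 * c + 3 : ℕ) : ℂ) by push_cast; ring, h, ZZ, Complex.ofReal_tsum]
  refine tsum_congr fun k => ?_
  push_cast
  rfl

lemma alt_ZZ (s : ℕ) (hs : 2 ≤ s) :
    ∑' k : ℕ, (-1 : ℝ) ^ k * (1 / (k : ℝ) ^ s) = 2 * (1 / 2 ^ s) * ZZ s - ZZ s := by
  have h0 := ZZ_summable s hs
  have ha : Summable (fun k : ℕ => (-1 : ℝ) ^ k * (1 / (k : ℝ) ^ s)) := by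
    refine Summable.of_norm_bounded h0 fun k => ?_
    rw [norm_mul, norm_pow, norm_neg, norm_one, one_pow, one_mul, Real.norm_of_nonneg (by positivity)]
  have i1 : Function.Injective (fun k : ℕ => 2 * k) := fun a b h => by simpa using h
  have i2 : Function.Injective (fun k : ℕ => 2 * k + 1) := fun a b h => by simpa using h
  have e0 : ∑' k : ℕ, 1 / ((2 * k : ℕ) : ℝ) ^ s = 1 / 2 ^ s * ZZ s := by
    rw [ZZ, ← tsum_mul_left]
    refine tsum_congr fun k => ?_
    push_cast
    rw [mul_pow, one_div_mul_one_div]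
  have e1 := tsum_even_add_odd (f := fun k : ℕ => 1 / (k : ℝ) ^ s) (h0.comp_injective i1) (h0.comp_injective i2)
  have e2 := tsum_even_add_odd (f := fun k : ℕ => (-1 : ℝ) ^ k * (1 / (k : ℝ) ^ s)) (ha.comp_injective i1) (ha.comp_injective i2)
  have e3 : ∀ k : ℕ, (-1 : ℝ) ^ (2 * k) = 1 := fun k => by rw [pow_mul]; simp
  simp only [pow_succ (-1 : ℝ), e3, one_mul, mul_neg, neg_mul, mul_one, tsum_neg] at e2
  rw [e0] at e1 e2
  rw [← e2]
  change _ = ZZ s at e1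
  linarith

lemma Gr_even (c : ℕ) (hc : Even c) : Gr c = (1 / 4) ^ c * (2 - 8 * 4 ^ c) * ZZ (2 * c + 3) := by
  rw [Gr, if_neg (by simpa using hc), add_zero, G0]
  have : ∀ k : ℕ, 8 * (-1) ^ k / (k : ℝ) ^ 3 * (-mu k) ^ c = 8 * ((-1 : ℝ) ^ k * (1 / (k : ℝ) ^ (2 * c + 3))) := by
    intro k
    have h1 : (-mu k) ^ c = 1 / (k : ℝ) ^ (2 * c) := by
      rw [hc.neg_pow, mu, div_pow, ← pow_mul, mul_comm k c, pow_mul, hc.neg_one_pow, one_pow, ← pow_mul]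
    rw [h1, pow_add]
    rw [← one_div_mul_one_div]; ring
  rw [tsum_congr this, tsum_mul_left, alt_ZZ _ (by omega)]
  have h4 : (2 : ℝ) ^ (2 * c + 3) = 8 * 4 ^ c := by rw [pow_add, pow_mul]; norm_num; ring
  rw [h4, one_div_pow]
  field_simp

lemma Gr_odd (j : ℕ) : Gr (2 * j + 1) = (-8 - (-(1 / 4)) ^ j) * ZZ (2 * (2 * j + 1) + 3) := by
  rw [Gr, if_pos ⟨j, rfl⟩, show (2 * j + 1) / 2 = j by omega, G0, E1]
  have h1 : ∀ k : ℕ, 8 * (-1) ^ k / (k : ℝ) ^ 3 * (-mu k) ^ (2 * j + 1) = -8 * (1 / (k : ℝ) ^ (2 * (2 * j + 1) + 3)) := by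
    intro k
    have he := neg_one_sq' k
    have h2 : (-mu k) ^ (2 * j + 1) = -((-1) ^ k * (1 / (k : ℝ) ^ (2 * (2 * j + 1)))) := by
      rw [Odd.neg_pow ⟨j, rfl⟩, mu, div_pow, ← pow_mul, mul_comm k, pow_mul (-1 : ℝ), Odd.neg_one_pow ⟨j, rfl⟩, ← pow_mul]
      ring
    rw [h2, pow_add, ← one_div_mul_one_div]
    linear_combination (-8 * (1 / (k : ℝ) ^ (2 * (2 * j + 1))) * (1 / (k : ℝ) ^ 3)) * he
  have h3 : ∀ k : ℕ, -(1 / (k : ℝ) ^ 5) * (-(1 / (4 * (k : ℝ) ^ 4))) ^ j = -(-(1 / 4)) ^ j * (1 / (k : ℝ) ^ (2 * (2 * j + 1) + 3)) := by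
    intro k
    rw [show -(1 / (4 * (k : ℝ) ^ 4)) = -(1 / 4) * (1 / (k : ℝ) ^ 4) by rw [← one_div_mul_one_div]; ring, mul_pow,
      one_div_pow ((k : ℝ) ^ 4), ← pow_mul, show 2 * (2 * j + 1) + 3 = 5 + 4 * j by ring, pow_add, ← one_div_mul_one_div]
    ring
  rw [tsum_congr h1, tsum_congr h3, tsum_mul_left, tsum_mul_left]
  change -8 * ZZ _ + _ * ZZ _ = _
  ring

noncomputable def gco (c : ℕ) : ℂ := (1 / 4) ^ c * riemannZeta (2 * (c : ℂ) + 3) *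
  (2 * (if Even c then 1 else 0) + (2 * Complex.I) ^ (c + 1) * (if Odd c then 1 else 0) - 8 * 4 ^ c)

lemma gco_eq (c : ℕ) : gco c = (Gr c : ℂ) := by
  rw [gco, zeta_ZZ]
  rcases Nat.even_or_odd c with hc | hc
  · rw [if_pos hc, if_neg (by simpa using hc), Gr_even c hc]
    push_cast; ring
  · rw [if_neg (by simpa using hc), if_pos hc]
    obtain ⟨j, rfl⟩ := hc
    rw [Gr_odd]
    have h1 : (2 * Complex.I) ^ (2 * j + 1 + 1) = (-4) ^ (j + 1) := by
      rw [show 2 * j + 1 + 1 = 2 * (j + 1) by ring, pow_mul, mul_pow, Complex.I_sq]; norm_num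
    have h2 : (1 / 4 : ℂ) ^ (2 * j + 1) * (-4) ^ (j + 1) = -(-(1 / 4)) ^ j := by
      rw [show 2 * j + 1 = j + (j + 1) by ring, pow_add, mul_assoc, ← mul_pow, pow_succ _ j]
      rw [show (1 / 4 * -4 : ℂ) = -1 by norm_num, neg_pow (1 / 4 : ℂ)]; ring
    have h3 : (1 / 4 : ℂ) ^ (2 * j + 1) * 4 ^ (2 * j + 1) = 1 := by
      rw [← mul_pow]; norm_num
    rw [h1]
    push_cast
    linear_combination (ZZ (2 * (2 * j + 1) + 3) : ℂ) * h2 - 8 * (ZZ (2 * (2 * j + 1) + 3) : ℂ) * h3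

lemma triple_sum (F : ℕ → ℕ → ℕ → ℂ) (m : ℕ) :
    ∑ p ∈ (Finset.range (m + 1) ×ˢ Finset.range (m + 1) ×ˢ Finset.range (m + 1)).filter
      (fun p => p.1 + p.2.1 + p.2.2 = m), F p.1 p.2.1 p.2.2 =
    ∑ c ∈ Finset.range (m + 1), ∑ x ∈ Finset.HasAntidiagonal.antidiagonal (m - c), F x.1 x.2 c := by
  rw [Finset.sum_sigma']
  refine Finset.sum_nbij' (fun p => ⟨p.2.2, (p.1, p.2.1)⟩) (fun q => (q.2.1, q.2.2, q.1)) ?_ ?_ ?_ ?_ ?_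
  · rintro ⟨a, b, c⟩ h
    simp only [Finset.mem_filter, Finset.mem_product, Finset.mem_range, Finset.mem_sigma, Finset.HasAntidiagonal.mem_antidiagonal] at h ⊢
    omega
  · rintro ⟨c, a, b⟩ h
    simp only [Finset.mem_filter, Finset.mem_product, Finset.mem_range, Finset.mem_sigma, Finset.HasAntidiagonal.mem_antidiagonal] at h ⊢
    omega
  · rintro ⟨a, b, c⟩ h; rfl
  · rintro ⟨c, a, b⟩ h; rfl
  · rintro ⟨a, b, c⟩ h; rfl

lemma conv_sum (n : ℕ) : ∑ c ∈ Finset.range (2 * n + 2 + 1), pco (2 * n + 2 - c) * gco c =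
    -(Real.pi ^ 2 / 8) * (zetaStar (Fin.cons 2 (Fin.cons 3 (pat13 n))) : ℂ) := by
  rw [Finset.sum_range_succ, Nat.sub_self, pco_eq.1, zero_mul, add_zero]
  have h := congrArg (fun x : ℝ => (x : ℂ)) (main_sum n)
  simp only [Complex.ofReal_sum, Complex.ofReal_mul, Complex.ofReal_ofNat] at h
  have e : ∀ c ∈ Finset.range (2 * n + 2), pco (2 * n + 2 - c) * gco c = -(Real.pi ^ 2 / 16) * ((Pd (2 * n + 1 - c) : ℂ) * (Gr c : ℂ)) := by
    intro c hc
    rw [Finset.mem_range] at hc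
    rw [show 2 * n + 2 - c = (2 * n + 1 - c) + 1 by omega, pco_eq.2, gco_eq]; ring
  rw [Finset.sum_congr rfl e, ← Finset.mul_sum, h]
  ring

/-- The evaluation of `ζ⋆(2, 3, {1,3}^n)` in terms of Riemann zeta
values (with the convention `ζ(0) = −1/2`, which `riemannZeta` satisfies). -/
theorem zetaStar_2_3_1313 (n : ℕ) :
    ((zetaStar (Fin.cons 2 (Fin.cons 3 (pat13 n))) : ℝ) : ℂ) =
      -(1 / (12 * riemannZeta 2)) *
          ∑ p ∈ (Finset.range (2 * n + 3) ×ˢ Finset.range (2 * n + 3) ×ˢ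
              Finset.range (2 * n + 3)).filter
              (fun p => p.1 + p.2.1 + p.2.2 = 2 * n + 2),
            (-1 : ℂ) ^ p.1 * (1 - 2 ^ (2 * p.1)) / 16 ^ n *
              riemannZeta (2 * p.1) * riemannZeta (2 * p.2.1) *
              riemannZeta (2 * p.2.2 + 3) *
              (2 * (if Even p.2.2 then 1 else 0)
                + (2 * Complex.I) ^ (p.2.2 + 1) * (if Odd p.2.2 then 1 else 0)
                - 8 * 4 ^ p.2.2) := by
  have hS := triple_sum (fun a b c => (-1 : ℂ) ^ a * (1 - 2 ^ (2 * a)) / 16 ^ n *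
              riemannZeta (2 * a) * riemannZeta (2 * b) *
              riemannZeta (2 * c + 3) *
              (2 * (if Even c then 1 else 0)
                + (2 * Complex.I) ^ (c + 1) * (if Odd c then 1 else 0)
                - 8 * 4 ^ c)) (2 * n + 2)
  have hT : ∀ c ∈ Finset.range (2 * n + 2 + 1), ∑ x ∈ Finset.HasAntidiagonal.antidiagonal (2 * n + 2 - c), (-1 : ℂ) ^ x.1 * (1 - 2 ^ (2 * x.1)) / 16 ^ n *
              riemannZeta (2 * x.1) * riemannZeta (2 * x.2) *
              riemannZeta (2 * c + 3) *
              (2 * (if Even c then 1 else 0)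
                + (2 * Complex.I) ^ (c + 1) * (if Odd c then 1 else 0)
                - 8 * 4 ^ c) = 16 * (pco (2 * n + 2 - c) * gco c) := by
    intro c hc
    rw [Finset.mem_range] at hc
    rw [pco, Finset.sum_mul, Finset.mul_sum]
    refine Finset.sum_congr rfl fun x hx => ?_
    rw [Finset.HasAntidiagonal.mem_antidiagonal] at hx
    rw [aco, bco, gco, pow_mul (2 : ℂ) 2 x.1, show (2 : ℂ) ^ 2 = 4 by norm_num]
    have h1 : (1 / 4 : ℂ) ^ x.1 * (1 / 4) ^ x.2 * (1 / 4) ^ c = 1 / 16 / 16 ^ n := by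
      rw [← pow_add, ← pow_add, hx, show 2 * n + 2 - c + c = 2 * n + 2 by omega, pow_add, pow_mul, div_pow, div_pow]
      norm_num
      ring
    have h2 : (1 / 16 ^ n : ℂ) = 16 * ((1 / 4 : ℂ) ^ x.1 * (1 / 4) ^ x.2 * (1 / 4) ^ c) := by
      rw [h1]; ring
    rw [div_eq_mul_one_div _ ((16 : ℂ) ^ n), h2]
    ring
  rw [Finset.sum_congr rfl hT, ← Finset.mul_sum, conv_sum] at hS
  rw [show 2 * n + 3 = 2 * n + 2 + 1 by ring, hS, riemannZeta_two]
  have hpi : (Real.pi : ℂ) ≠ 0 := by exact_mod_cast Real.pi_ne_zero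
  field_simp
  ring
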